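/- arXiv:math/0607153 — 3 statements merged into one kernel-verified Lean document; each statement's English description precedes it below -/
import Mathlib

section
/- Let p ≥ 3 and q ≥ 1. Let f : Ω → f(Ω) ⊂ M₀ be a conformal diffeomorphism with respect to g, defined on an open set Ω ⊂ M₀, and assume that Df(z)(T_z S) = T_{f(z)} S and Df(z)(T_z H) = T_{f(z)} H for every z ∈ Ω. Then f preserves the Ricci tensor of g: Ric_{f(z)}(Df(z)U, Df(z)V) = Ric_z(U, V) for all z ∈ Ω and all U, V ∈ ℝ^{p+q}. -/
noncomputable section

open scoped RealInnerProductSpace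

/-- Points/tangent vectors of `M = ℝ^p × ℝ^q` with Euclidean norms on the factors. -/
abbrev GVec (p q : ℕ) := EuclideanSpace ℝ (Fin p) × EuclideanSpace ℝ (Fin q)

/-- The set `M₀ = (ℝ^p \ {0}) × ℝ^q`. -/
def GM0 (p q : ℕ) : Set (GVec p q) := {z | z.1 ≠ 0}

/-- Homogeneous norm `‖(x,y)‖ = (|x|^{2(α+1)} + |y|²)^{1/(2(α+1))}`. -/
def homNorm (α : ℝ) (p q : ℕ) (z : GVec p q) : ℝ :=
  (‖z.1‖ ^ (2 * (α + 1)) + ‖z.2‖ ^ 2) ^ (1 / (2 * (α + 1)))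

/-- Anisotropic dilation `δ_t(x,y) = (t x, t^{α+1} y)`. -/
def gdil (α : ℝ) (p q : ℕ) (t : ℝ) (z : GVec p q) : GVec p q :=
  (t • z.1, (t ^ (α + 1)) • z.2)

/-- Grushin inversion `Φ(z) = δ_{‖z‖^{-2}} z = (x/‖z‖², y/‖z‖^{2(α+1)})`. -/
def ginv (α : ℝ) (p q : ℕ) (z : GVec p q) : GVec p q :=
  ((homNorm α p q z ^ (-(2:ℝ))) • z.1, (homNorm α p q z ^ (-(2 * (α + 1)))) • z.2)

/-- The Riemannian metric `g = (α+1)²|x|^{2α}|dx|² + |dy|²` (depends on the point through `x`). -/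
def gMet (α : ℝ) (p q : ℕ) (x : EuclideanSpace ℝ (Fin p)) (U V : GVec p q) : ℝ :=
  (α + 1) ^ 2 * ‖x‖ ^ (2 * α) * ⟪U.1, V.1⟫ + ⟪U.2, V.2⟫

/-- The Riemannian metric `ĝ = |dx|² + |dy|²/((α+1)²|x|^{2α})`. -/
def ghat (α : ℝ) (p q : ℕ) (x : EuclideanSpace ℝ (Fin p)) (U V : GVec p q) : ℝ :=
  ⟪U.1, V.1⟫ + ⟪U.2, V.2⟫ / ((α + 1) ^ 2 * ‖x‖ ^ (2 * α))

/-- Contraction `Γ(U,V)^k = Γ^k_{ij}U^iV^j` of the Christoffel symbols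
`Γ^k_{ij} = α|x|^{-2}(δ_{ik}x_j + δ_{jk}x_i − δ_{ij}x_k)` (x-indices; all other symbols zero). -/
def gammaMap (α : ℝ) (p q : ℕ) (x : EuclideanSpace ℝ (Fin p)) (U V : GVec p q) : GVec p q :=
  ((α * ‖x‖ ^ (-(2:ℝ))) • (⟪x, V.1⟫ • U.1 + ⟪x, U.1⟫ • V.1 - ⟪U.1, V.1⟫ • x), 0)

/-- Covariant derivative `∇_U V` of a vector field `V` along the constant direction `U`, at `z`. -/
def covDeriv (α : ℝ) (p q : ℕ) (V : GVec p q → GVec p q) (z : GVec p q) (U : GVec p q) :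
    GVec p q :=
  fderiv ℝ V z U + gammaMap α p q z.1 U (V z)

/-- Curvature operator `R(X,Y)Z = ∇_X ∇_Y Z − ∇_Y ∇_X Z` on constant (hence commuting) vector
fields `X, Y, Z`, evaluated at `z`. -/
def curvOp (α : ℝ) (p q : ℕ) (z : GVec p q) (X Y Z : GVec p q) : GVec p q :=
  covDeriv α p q (fun w => gammaMap α p q w.1 Y Z) z X
    - covDeriv α p q (fun w => gammaMap α p q w.1 X Z) z Y

/-- Riemann curvature tensor `R(U,V,X,Y) = g(U, R(X,Y)V)`. -/
def riem (α : ℝ) (p q : ℕ) (z : GVec p q) (U V X Y : GVec p q) : ℝ :=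
  gMet α p q z.1 U (curvOp α p q z X Y V)

/-- Ricci tensor `Ric(X,Y) = trace (V ↦ R(V,Y)X)`. -/
def ricci (α : ℝ) (p q : ℕ) (z : GVec p q) (X Y : GVec p q) : ℝ :=
  (∑ i : Fin p, (curvOp α p q z (EuclideanSpace.single i 1, 0) Y X).1 i)
    + ∑ l : Fin q, (curvOp α p q z (0, EuclideanSpace.single l 1) Y X).2 l

/-- Scalar curvature: the `g`-trace of the Ricci tensor. -/
def scal (α : ℝ) (p q : ℕ) (z : GVec p q) : ℝ :=
  ((α + 1) ^ 2 * ‖z.1‖ ^ (2 * α))⁻¹ *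
      (∑ i : Fin p, ricci α p q z (EuclideanSpace.single i 1, 0) (EuclideanSpace.single i 1, 0))
    + ∑ l : Fin q, ricci α p q z (0, EuclideanSpace.single l 1) (0, EuclideanSpace.single l 1)

/-- The Weyl tensor
`W = R + (1/(n−2)) Ric ⊙ g − (Scal/(2(n−1)(n−2))) g ⊙ g`, where
`(h ⊙ s)(X₁,X₂,X₃,X₄) = h(X₁,X₄)s(X₂,X₃) + h(X₂,X₃)s(X₁,X₄) − h(X₁,X₃)s(X₂,X₄) − h(X₂,X₄)s(X₁,X₃)`
and `n = p + q`. -/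
def weyl (α : ℝ) (p q : ℕ) (z : GVec p q) (X₁ X₂ X₃ X₄ : GVec p q) : ℝ :=
  riem α p q z X₁ X₂ X₃ X₄
    + ((p + q : ℝ) - 2)⁻¹ *
        (ricci α p q z X₁ X₄ * gMet α p q z.1 X₂ X₃ + ricci α p q z X₂ X₃ * gMet α p q z.1 X₁ X₄
          - ricci α p q z X₁ X₃ * gMet α p q z.1 X₂ X₄
          - ricci α p q z X₂ X₄ * gMet α p q z.1 X₁ X₃)
    - scal α p q z / (2 * ((p + q : ℝ) - 1) * ((p + q : ℝ) - 2)) *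
        (gMet α p q z.1 X₁ X₄ * gMet α p q z.1 X₂ X₃ + gMet α p q z.1 X₂ X₃ * gMet α p q z.1 X₁ X₄
          - gMet α p q z.1 X₁ X₃ * gMet α p q z.1 X₂ X₄
          - gMet α p q z.1 X₂ X₄ * gMet α p q z.1 X₁ X₃)

/-- Vertical subspace `T_z S = {(v,0) : ⟨v,x⟩ = 0}`. -/
def TSp (p q : ℕ) (z : GVec p q) : Set (GVec p q) := {U | U.2 = 0 ∧ ⟪U.1, z.1⟫ = 0}

/-- Horizontal subspace `T_z H = {(t x, w) : t ∈ ℝ, w ∈ ℝ^q}`. -/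
def THp (p q : ℕ) (z : GVec p q) : Set (GVec p q) := {U | ∃ t : ℝ, U.1 = t • z.1}

/-- `g`-orthogonal projection of `U` onto the vertical subspace `T_z S`. -/
def projS (p q : ℕ) (z : GVec p q) (U : GVec p q) : GVec p q :=
  (U.1 - (⟪U.1, z.1⟫ / ‖z.1‖ ^ 2) • z.1, 0)

/-- Control (Carnot–Carathéodory) distance of the Grushin vector fields
`X_j = ∂_{x_j}`, `Y_λ = (α+1)|x|^α ∂_{y_λ}`: the infimum of `∫₀ᵀ √(|a|²+|b|²)` over absolutely
continuous admissible paths `γ̇ = Σ aⱼ Xⱼ(γ) + Σ b_λ Y_λ(γ)` joining the two points. -/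
def grushinDist (α : ℝ) (p q : ℕ) (z z' : GVec p q) : ℝ :=
  sInf { L : ℝ |
    ∃ (T : ℝ) (γ : ℝ → GVec p q) (a : ℝ → EuclideanSpace ℝ (Fin p))
      (b : ℝ → EuclideanSpace ℝ (Fin q)),
      0 ≤ T ∧ γ 0 = z ∧ γ T = z' ∧
      (∀ t ∈ Set.Icc (0:ℝ) T,
        γ t = (z.1 + ∫ s in (0:ℝ)..t, a s,
               z.2 + ∫ s in (0:ℝ)..t, ((α + 1) * ‖(γ s).1‖ ^ α) • b s)) ∧
      L = ∫ t in (0:ℝ)..T, Real.sqrt (‖a t‖ ^ 2 + ‖b t‖ ^ 2) }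


open scoped ContDiff

/-- The round metric on directions: `⟪Dν A, Dν B⟫` for `ν x = x / ‖x‖`. -/
def dirForm {E : Type*} [NormedAddCommGroup E] [InnerProductSpace ℝ E] (x A B : E) : ℝ :=
  ⟪A, B⟫ / ‖x‖ ^ 2 - ⟪A, x⟫ * ⟪B, x⟫ / (‖x‖ ^ 2) ^ 2

section Smooth

variable {P G : Type*} [NormedAddCommGroup P] [NormedSpace ℝ P]
  [NormedAddCommGroup G] [NormedSpace ℝ G] {S : Set P} {φ : P → G}

lemma contDiffOn_fderiv_apply (hS : IsOpen S) (hφ : ContDiffOn ℝ ∞ φ S) (A : P) :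
    ContDiffOn ℝ ∞ (fun z => fderiv ℝ φ z A) S :=
  (hφ.fderiv_of_isOpen hS (m := ∞) (by simp)).clm_apply contDiffOn_const

lemma ContDiffOn.differentiableAt_of_isOpen (hS : IsOpen S) (hφ : ContDiffOn ℝ ∞ φ S) {z : P}
    (hz : z ∈ S) : DifferentiableAt ℝ φ z :=
  (hφ.contDiffAt (hS.mem_nhds hz)).differentiableAt (by simp)

lemma fderiv_congr_of_isOpen (hS : IsOpen S) {ψ : P → G} (h : ∀ z ∈ S, φ z = ψ z) {z : P}
    (hz : z ∈ S) : fderiv ℝ φ z = fderiv ℝ ψ z :=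
  Filter.EventuallyEq.fderiv_eq (Filter.eventuallyEq_of_mem (hS.mem_nhds hz) h)

lemma fderiv_fderiv_apply (hS : IsOpen S) (hφ : ContDiffOn ℝ ∞ φ S) {z : P} (hz : z ∈ S)
    (A B : P) : fderiv ℝ (fun z => fderiv ℝ φ z A) z B = fderiv ℝ (fderiv ℝ φ) z B A := by
  have h : DifferentiableAt ℝ (fderiv ℝ φ) z :=
    (hφ.fderiv_of_isOpen hS (m := ∞) (by simp)).differentiableAt_of_isOpen hS hz
  rw [fderiv_clm_apply h (differentiableAt_const A)]
  simp

lemma fderiv_fderiv_comm (hS : IsOpen S) (hφ : ContDiffOn ℝ ∞ φ S) {z : P} (hz : z ∈ S)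
    (A B : P) : fderiv ℝ (fun z => fderiv ℝ φ z A) z B =
      fderiv ℝ (fun z => fderiv ℝ φ z B) z A := by
  rw [fderiv_fderiv_apply hS hφ hz, fderiv_fderiv_apply hS hφ hz]
  exact ((hφ.contDiffAt (hS.mem_nhds hz)).isSymmSndFDerivAt (by simpa using ENat.LEInfty.out)).eq B A

/-- If `φ` is invariant under the affine vector field `z ↦ T z + b`, the Lie derivative of `dφ`
along it vanishes. -/
lemma fderiv_fderiv_of_invariant (hS : IsOpen S) (hφ : ContDiffOn ℝ ∞ φ S) (T : P →L[ℝ] P) (b : P)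
    (hinv : ∀ z ∈ S, fderiv ℝ φ z (T z + b) = 0) {z : P} (hz : z ∈ S) (V : P) :
    fderiv ℝ (fun z => fderiv ℝ φ z V) z (T z + b) = - fderiv ℝ φ z (T V) := by
  have h : DifferentiableAt ℝ (fderiv ℝ φ) z :=
    (hφ.fderiv_of_isOpen hS (m := ∞) (by simp)).differentiableAt_of_isOpen hS hz
  have hX : HasFDerivAt (fun z => T z + b) T z := T.hasFDerivAt.add_const b
  have h0 := (h.hasFDerivAt.clm_apply hX).fderiv
  rw [fderiv_congr_of_isOpen hS (ψ := fun _ => (0 : G)) hinv hz] at h0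
  have h1 := congrArg (fun L => L V) h0
  simp at h1
  rw [fderiv_fderiv_apply hS hφ hz,
    ((hφ.contDiffAt (hS.mem_nhds hz)).isSymmSndFDerivAt (by simpa using ENat.LEInfty.out)).eq, map_add]
  exact eq_neg_of_add_eq_zero_right h1.symm

end Smooth

section Gauss

variable {P E : Type*} [NormedAddCommGroup P] [NormedSpace ℝ P]
  [NormedAddCommGroup E] [InnerProductSpace ℝ E] {S : Set P} {m : P → E}

lemma fderiv_inner_of_isOpen (hS : IsOpen S) {φ ψ : P → E} (hφ : ContDiffOn ℝ ∞ φ S)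
    (hψ : ContDiffOn ℝ ∞ ψ S) {z : P} (hz : z ∈ S) (A : P) :
    fderiv ℝ (fun z => ⟪φ z, ψ z⟫) z A = ⟪φ z, fderiv ℝ ψ z A⟫ + ⟪fderiv ℝ φ z A, ψ z⟫ :=
  fderiv_inner_apply ℝ (hφ.differentiableAt_of_isOpen hS hz)
    (hψ.differentiableAt_of_isOpen hS hz) A

/-- Koszul's formula for the metric induced by `m`. -/
lemma koszul_induced (hS : IsOpen S) (hm : ContDiffOn ℝ ∞ m S) (K : P → P → P → ℝ)
    (hK : ∀ z ∈ S, ∀ A B, ⟪fderiv ℝ m z A, fderiv ℝ m z B⟫ = K A B z) {z : P} (hz : z ∈ S)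
    (A B C : P) :
    2 * ⟪fderiv ℝ (fun z => fderiv ℝ m z A) z B, fderiv ℝ m z C⟫ =
      fderiv ℝ (K A C) z B + fderiv ℝ (K B C) z A - fderiv ℝ (K A B) z C := by
  have key : ∀ A B C, fderiv ℝ (K A B) z C =
      ⟪fderiv ℝ m z A, fderiv ℝ (fun z => fderiv ℝ m z B) z C⟫ +
      ⟪fderiv ℝ (fun z => fderiv ℝ m z A) z C, fderiv ℝ m z B⟫ := fun A B C => by
    rw [← fderiv_inner_of_isOpen hS (contDiffOn_fderiv_apply hS hm A)
      (contDiffOn_fderiv_apply hS hm B) hz,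
      fderiv_congr_of_isOpen hS (fun z hz => hK z hz A B) hz]
  rw [key, key, key, fderiv_fderiv_comm hS hm hz B A, fderiv_fderiv_comm hS hm hz C A,
    fderiv_fderiv_comm hS hm hz C B, real_inner_comm (fderiv ℝ m z B)]
  ring

/-- The second derivatives of the metric induced by `m` that make up its curvature only involve
second derivatives of `m`. -/
lemma gauss_induced (hS : IsOpen S) (hm : ContDiffOn ℝ ∞ m S) (K : P → P → P → ℝ)
    (hK : ∀ z ∈ S, ∀ A B, ⟪fderiv ℝ m z A, fderiv ℝ m z B⟫ = K A B z) {z : P} (hz : z ∈ S)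
    (U V : P) :
    2 * fderiv ℝ (fun z => fderiv ℝ (K U V) z V) z U - fderiv ℝ (fun z => fderiv ℝ (K U U) z V) z V
        - fderiv ℝ (fun z => fderiv ℝ (K V V) z U) z U =
      2 * (⟪fderiv ℝ (fun z => fderiv ℝ m z U) z U, fderiv ℝ (fun z => fderiv ℝ m z V) z V⟫ -
        ⟪fderiv ℝ (fun z => fderiv ℝ m z U) z V, fderiv ℝ (fun z => fderiv ℝ m z U) z V⟫) := by
  have h1 := contDiffOn_fderiv_apply hS hm
  have h2 := fun A B => contDiffOn_fderiv_apply hS (h1 A) B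
  have key : ∀ A B C, ∀ z ∈ S, fderiv ℝ (K A B) z C =
      ⟪fderiv ℝ m z A, fderiv ℝ (fun z => fderiv ℝ m z B) z C⟫ +
      ⟪fderiv ℝ (fun z => fderiv ℝ m z A) z C, fderiv ℝ m z B⟫ := fun A B C z hz => by
    rw [← fderiv_inner_of_isOpen hS (h1 A) (h1 B) hz,
      fderiv_congr_of_isOpen hS (fun z hz => hK z hz A B) hz]
  have key2 : ∀ A B C D, fderiv ℝ (fun z => fderiv ℝ (K A B) z C) z D =
      ⟪fderiv ℝ m z A, fderiv ℝ (fun z => fderiv ℝ (fun z => fderiv ℝ m z B) z C) z D⟫ +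
      ⟪fderiv ℝ (fun z => fderiv ℝ m z A) z D, fderiv ℝ (fun z => fderiv ℝ m z B) z C⟫ +
      (⟪fderiv ℝ (fun z => fderiv ℝ m z A) z C, fderiv ℝ (fun z => fderiv ℝ m z B) z D⟫ +
      ⟪fderiv ℝ (fun z => fderiv ℝ (fun z => fderiv ℝ m z A) z C) z D, fderiv ℝ m z B⟫) :=
    fun A B C D => by
    rw [fderiv_congr_of_isOpen hS (key A B C) hz, fderiv_fun_add
      (((h1 A).inner ℝ (h2 B C)).differentiableAt_of_isOpen hS hz)
      (((h2 A C).inner ℝ (h1 B)).differentiableAt_of_isOpen hS hz), add_apply,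
      fderiv_inner_of_isOpen hS (h1 A) (h2 B C) hz, fderiv_inner_of_isOpen hS (h2 A C) (h1 B) hz]
  have third : ∀ A B, fderiv ℝ (fun z => fderiv ℝ (fun z => fderiv ℝ m z A) z A) z B =
      fderiv ℝ (fun z => fderiv ℝ (fun z => fderiv ℝ m z B) z A) z A := fun A B => by
    rw [fderiv_fderiv_comm hS (h1 A) hz,
      fderiv_congr_of_isOpen hS (fun z hz => fderiv_fderiv_comm hS hm hz A B) hz]
  have fourth : fderiv ℝ (fun z => fderiv ℝ (fun z => fderiv ℝ m z U) z V) z U =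
      fderiv ℝ (fun z => fderiv ℝ (fun z => fderiv ℝ m z V) z U) z U := by
    rw [fderiv_congr_of_isOpen hS (fun z hz => fderiv_fderiv_comm hS hm hz U V) hz]
  rw [key2, key2, key2, third V U, fourth, fderiv_fderiv_comm hS hm hz V U,
    real_inner_comm (fderiv ℝ m z U) (fderiv ℝ (fun z => fderiv ℝ (fun z => fderiv ℝ m z U) z V) z V),
    real_inner_comm (fderiv ℝ m z V)]
  ring

end Gauss

section UnitDir

variable {P E : Type*} [NormedAddCommGroup P] [NormedSpace ℝ P]
  [NormedAddCommGroup E] [InnerProductSpace ℝ E]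

lemma HasFDerivAt.inv_real {φ : P → ℝ} {φ' : P →L[ℝ] ℝ} {z : P} (h : HasFDerivAt φ φ' z)
    (h0 : φ z ≠ 0) : HasFDerivAt (fun z => (φ z)⁻¹) ((-(φ z ^ 2)⁻¹) • φ') z :=
  (hasDerivAt_inv h0).comp_hasFDerivAt z h

/-- The direction `x / ‖x‖` of a vector. -/
def unitDir (x : E) : E := ‖x‖⁻¹ • x

lemma inner_unitDir_self {x : E} (hx : x ≠ 0) : ⟪unitDir x, unitDir x⟫ = 1 := by
  have h := norm_ne_zero_iff.2 hx
  rw [unitDir, real_inner_smul_left, real_inner_smul_right, real_inner_self_eq_norm_sq]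
  field_simp

lemma ContDiffOn.unitDir {S : Set P} {g : P → E} (hg : ContDiffOn ℝ ∞ g S)
    (h0 : ∀ z ∈ S, g z ≠ 0) : ContDiffOn ℝ ∞ (fun z => unitDir (g z)) S :=
  ((hg.norm ℝ h0).inv fun z hz => norm_ne_zero_iff.2 (h0 z hz)).smul hg

lemma fderiv_unitDir_comp {g : P → E} {z : P} (hg : DifferentiableAt ℝ g z) (h0 : g z ≠ 0)
    (A : P) : fderiv ℝ (fun z => unitDir (g z)) z A =
      ‖g z‖⁻¹ • fderiv ℝ g z A - (⟪g z, fderiv ℝ g z A⟫ / ‖g z‖ ^ 3) • g z := by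
  have hn := norm_ne_zero_iff.2 h0
  have hfun : (fun z => unitDir (g z)) = fun z => (Real.sqrt ⟪g z, g z⟫)⁻¹ • g z := by
    ext z; simp only [unitDir, norm_eq_sqrt_real_inner]
  have h1 := hg.hasFDerivAt.inner ℝ hg.hasFDerivAt
  have hpos : ⟪g z, g z⟫ ≠ 0 := inner_self_ne_zero.2 h0
  have h2 := ((h1.sqrt hpos).inv_real (by rw [← norm_eq_sqrt_real_inner]; exact hn)).smul hg.hasFDerivAt
  rw [hfun]
  refine (congrArg (fun L => L A) h2.fderiv).trans ?_
  simp [real_inner_comm (g z)]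
  rw [sub_eq_add_neg]
  congr 3
  field_simp
  ring

lemma inner_fderiv_unitDir_comp {g : P → E} {z : P} (hg : DifferentiableAt ℝ g z) (h0 : g z ≠ 0)
    (A B : P) : ⟪fderiv ℝ (fun z => unitDir (g z)) z A, fderiv ℝ (fun z => unitDir (g z)) z B⟫ =
      dirForm (g z) (fderiv ℝ g z A) (fderiv ℝ g z B) := by
  have hn := norm_ne_zero_iff.2 h0
  rw [fderiv_unitDir_comp hg h0, fderiv_unitDir_comp hg h0, dirForm]
  simp only [inner_sub_left, inner_sub_right, real_inner_smul_left, real_inner_smul_right,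
    real_inner_self_eq_norm_sq, real_inner_comm (g z)]
  field_simp
  ring

lemma fderiv_dirForm {x : E} (hx : x ≠ 0) (A B C : E) :
    DifferentiableAt ℝ (fun x => dirForm x A B) x ∧ fderiv ℝ (fun x => dirForm x A B) x C =
      - (2 * ⟪x, C⟫ * ⟪A, B⟫ + ⟪A, C⟫ * ⟪B, x⟫ + ⟪A, x⟫ * ⟪B, C⟫) / ‖x‖ ^ 4
        + 4 * ⟪x, C⟫ * ⟪A, x⟫ * ⟪B, x⟫ / ‖x‖ ^ 6 := by
  have hn := norm_ne_zero_iff.2 hx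
  have hs : HasFDerivAt (fun x : E => ‖x‖ ^ 2) _ x := (hasFDerivAt_id x).norm_sq
  have hA : HasFDerivAt (fun x : E => ⟪A, x⟫) _ x := (innerSL ℝ A).hasFDerivAt
  have hB : HasFDerivAt (fun x : E => ⟪B, x⟫) _ x := (innerSL ℝ B).hasFDerivAt
  have hs2 : ‖x‖ ^ 2 ≠ 0 := pow_ne_zero 2 hn
  have h := ((hasFDerivAt_const ⟪A, B⟫ x).mul (hs.inv_real hs2)).sub
    ((hA.mul hB).mul ((hs.pow 2).inv_real (pow_ne_zero 2 hs2)))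
  have hfun : (fun x => dirForm x A B) = fun x => ⟪A, B⟫ * (‖x‖ ^ 2)⁻¹ -
      ⟪A, x⟫ * ⟪B, x⟫ * ((‖x‖ ^ 2) ^ 2)⁻¹ := by
    ext y; simp only [dirForm, div_eq_mul_inv]
  rw [hfun]
  refine ⟨h.differentiableAt, (congrArg (fun L => L C) h.fderiv).trans ?_⟩
  simp
  field_simp
  ring

end UnitDir

section Rigidity

variable {E F : Type*} [NormedAddCommGroup E] [InnerProductSpace ℝ E]
  [NormedAddCommGroup F] [NormedSpace ℝ F] {S : Set (E × F)}

lemma fderiv_dirForm_fst {z : E × F} (hz : z.1 ≠ 0) (A B : E) (C : E × F) :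
    fderiv ℝ (fun z : E × F => dirForm z.1 A B) z C =
      - (2 * ⟪z.1, C.1⟫ * ⟪A, B⟫ + ⟪A, C.1⟫ * ⟪B, z.1⟫ + ⟪A, z.1⟫ * ⟪B, C.1⟫) / ‖z.1‖ ^ 4
        + 4 * ⟪z.1, C.1⟫ * ⟪A, z.1⟫ * ⟪B, z.1⟫ / ‖z.1‖ ^ 6 := by
  obtain ⟨hd, h⟩ := fderiv_dirForm hz A B C.1
  have := fderiv_comp z (f := fun z : E × F => z.1) hd differentiableAt_fst
  rw [← h]
  refine (congrArg (fun L => L C) this).trans ?_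
  simp [fderiv_fst]

lemma fderiv_const_mul_apply {P : Type*} [NormedAddCommGroup P] [NormedSpace ℝ P] (c : ℝ)
    (φ : P → ℝ) (z A : P) : fderiv ℝ (fun z => c * φ z) z A = c * fderiv ℝ φ z A := by
  have := fderiv_const_smul_field (𝕜 := ℝ) c (f := φ)
  exact congrArg (fun L => L z A) this

lemma curvature_homothetic (hS : IsOpen S) (hS0 : ∀ z ∈ S, z.1 ≠ 0) {m : E × F → E}
    (hm : ContDiffOn ℝ ∞ m S) (hunit : ∀ z ∈ S, ⟪m z, m z⟫ = 1) {c : ℝ}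
    (hK : ∀ z ∈ S, ∀ A B, ⟪fderiv ℝ m z A, fderiv ℝ m z B⟫ = c * dirForm z.1 A.1 B.1)
    {z : E × F} (hz : z ∈ S) (hsurj : ∀ v, ⟪v, m z⟫ = 0 → ∃ A, fderiv ℝ m z A = v)
    {U V : E × F} (hUU : ⟪U.1, U.1⟫ = 1) (hVV : ⟪V.1, V.1⟫ = 1) (hUV : ⟪U.1, V.1⟫ = 0)
    (hU : ⟪U.1, z.1⟫ = 0) (hV : ⟪V.1, z.1⟫ = 0) :
    c * (2 * fderiv ℝ (fun z => fderiv ℝ (fun z => dirForm z.1 U.1 V.1) z V) z U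
        - fderiv ℝ (fun z => fderiv ℝ (fun z => dirForm z.1 U.1 U.1) z V) z V
        - fderiv ℝ (fun z => fderiv ℝ (fun z => dirForm z.1 V.1 V.1) z U) z U) =
      2 * c ^ 2 / ‖z.1‖ ^ 4 := by
  have hperp : ∀ z ∈ S, ∀ A, ⟪fderiv ℝ m z A, m z⟫ = 0 := fun z hz A => by
    have h := fderiv_inner_of_isOpen hS hm hm hz A
    rw [fderiv_congr_of_isOpen hS hunit hz, real_inner_comm (m z)] at h
    simp at h
    rw [real_inner_comm]
    linarith [real_inner_comm (m z) (fderiv ℝ m z A)]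
  have hnormal : ∀ A B, ⟪fderiv ℝ (fun z => fderiv ℝ m z A) z B, m z⟫ =
      - (c * dirForm z.1 A.1 B.1) := fun A B => by
    have h := fderiv_inner_of_isOpen hS (contDiffOn_fderiv_apply hS hm A) hm hz B
    rw [fderiv_congr_of_isOpen hS (fun z hz => hperp z hz A) hz, hK z hz] at h
    simp at h
    linarith
  have htan : ∀ A B, ⟪A.1, z.1⟫ = 0 → ⟪B.1, z.1⟫ = 0 → ∀ C,
      ⟪fderiv ℝ (fun z => fderiv ℝ m z A) z B, fderiv ℝ m z C⟫ = 0 := fun A B hA hB C => by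
    have h := koszul_induced hS hm (fun A B z => c * dirForm z.1 A.1 B.1) hK hz A B C
    simp only [fderiv_const_mul_apply, fderiv_dirForm_fst (hS0 z hz),
      real_inner_comm A.1 z.1, real_inner_comm B.1 z.1, hA, hB] at h
    rw [real_inner_comm C.1 z.1, real_inner_comm A.1 B.1] at h
    have h2 : 2 * ⟪fderiv ℝ (fun z => fderiv ℝ m z A) z B, fderiv ℝ m z C⟫ = 0 := by
      rw [h]; ring
    linarith
  have hsecond : ∀ A B, ⟪A.1, z.1⟫ = 0 → ⟪B.1, z.1⟫ = 0 →
      fderiv ℝ (fun z => fderiv ℝ m z A) z B = - (c * dirForm z.1 A.1 B.1) • m z :=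
    fun A B hA hB => by
    set w := fderiv ℝ (fun z => fderiv ℝ m z A) z B with hw
    have h0 : ⟪w - (-(c * dirForm z.1 A.1 B.1)) • m z, m z⟫ = 0 := by
      rw [inner_sub_left, real_inner_smul_left, hunit z hz, hw, hnormal]; ring
    obtain ⟨C, hC⟩ := hsurj _ h0
    have h1 : ⟪w - (-(c * dirForm z.1 A.1 B.1)) • m z, w - (-(c * dirForm z.1 A.1 B.1)) • m z⟫ = 0 := by
      nth_rw 2 [← hC]
      rw [inner_sub_left, real_inner_smul_left, htan A B hA hB C, real_inner_comm, hperp z hz]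
      ring
    exact sub_eq_zero.1 (inner_self_eq_zero.1 h1)
  have h := gauss_induced hS hm (fun A B z => c * dirForm z.1 A.1 B.1) hK hz U V
  rw [hsecond U U hU hU, hsecond V V hV hV, hsecond U V hU hV] at h
  simp only [fderiv_const_mul_apply, real_inner_smul_left, real_inner_smul_right, hunit z hz] at h
  have e1 : dirForm z.1 U.1 U.1 = 1 / ‖z.1‖ ^ 2 := by rw [dirForm, hUU, hU]; simp
  have e2 : dirForm z.1 V.1 V.1 = 1 / ‖z.1‖ ^ 2 := by rw [dirForm, hVV, hV]; simp
  have e3 : dirForm z.1 U.1 V.1 = 0 := by simp [dirForm, hUV, hU]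
  rw [e1, e2, e3] at h
  rw [mul_sub, mul_sub]
  have hn := norm_ne_zero_iff.2 (hS0 z hz)
  rw [show 2 * c ^ 2 / ‖z.1‖ ^ 4 =
    2 * (-(c * (1 / ‖z.1‖ ^ 2)) * (-(c * (1 / ‖z.1‖ ^ 2)) * 1) - -(c * 0) * (-(c * 0) * 1)) by
      field_simp; ring, ← h]
  ring

/-- A homothety between open pieces of the unit sphere of dimension at least two, presented by a
map `m` depending on the direction of the first variable only, is an isometry. -/
lemma homothety_const_eq_one (hS : IsOpen S) (hS0 : ∀ z ∈ S, z.1 ≠ 0) {m : E × F → E}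
    (hm : ContDiffOn ℝ ∞ m S) (hunit : ∀ z ∈ S, ⟪m z, m z⟫ = 1) {c : ℝ} (hc : c ≠ 0)
    (hK : ∀ z ∈ S, ∀ A B, ⟪fderiv ℝ m z A, fderiv ℝ m z B⟫ = c * dirForm z.1 A.1 B.1)
    {z : E × F} (hz : z ∈ S) (hsurj : ∀ v, ⟪v, m z⟫ = 0 → ∃ A, fderiv ℝ m z A = v)
    {a b : E} (haa : ⟪a, a⟫ = 1) (hbb : ⟪b, b⟫ = 1) (hab : ⟪a, b⟫ = 0)
    (ha : ⟪a, z.1⟫ = 0) (hb : ⟪b, z.1⟫ = 0) : c = 1 := by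
  have hn := norm_ne_zero_iff.2 (hS0 z hz)
  have hfst : ContDiffOn ℝ ∞ (fun z : E × F => z.1) S := contDiff_fst.contDiffOn
  have h1 := curvature_homothetic hS hS0 hm hunit hK hz hsurj (U := (a, 0)) (V := (b, 0))
    haa hbb hab ha hb
  have h2 := curvature_homothetic hS hS0 (hfst.unitDir hS0)
    (fun z hz => inner_unitDir_self (hS0 z hz)) (c := 1)
    (fun z hz A B => by
      rw [inner_fderiv_unitDir_comp differentiableAt_fst (hS0 z hz)]; simp [fderiv_fst])
    hz (fun v hv => ⟨(‖z.1‖ • v, 0), by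
      have hv' : ⟪z.1, v⟫ = 0 := by
        rw [unitDir, real_inner_smul_right, real_inner_comm] at hv
        exact (mul_eq_zero.1 hv).resolve_left (inv_ne_zero hn)
      rw [fderiv_unitDir_comp differentiableAt_fst (hS0 z hz)]
      simp [fderiv_fst, real_inner_smul_right, hv', smul_smul, hn]⟩)
    (U := (a, 0)) (V := (b, 0)) haa hbb hab ha hb
  rw [one_mul] at h2
  rw [h2] at h1
  field_simp at h1
  linarith

end Rigidity

section Pullback

variable {p q : ℕ}

lemma inner_proj_self {E : Type*} [NormedAddCommGroup E] [InnerProductSpace ℝ E] {x : E}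
    (hx : x ≠ 0) (A : E) : ⟪A - (⟪A, x⟫ / ‖x‖ ^ 2) • x, x⟫ = 0 := by
  have hn := norm_ne_zero_iff.2 hx
  rw [inner_sub_left, real_inner_smul_left, real_inner_self_eq_norm_sq]
  field_simp
  ring

lemma dirForm_eq_inner_of_perp {E : Type*} [NormedAddCommGroup E] [InnerProductSpace ℝ E]
    {x A B A' B' : E} (hx : x ≠ 0) (hA : ⟪A, x⟫ = 0) (hB : ⟪B, x⟫ = 0) {s t : ℝ}
    (hA' : A' = A + s • x) (hB' : B' = B + t • x) : dirForm x A' B' = ⟪A, B⟫ / ‖x‖ ^ 2 := by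
  have hn := norm_ne_zero_iff.2 hx
  have hB2 : ⟪x, B⟫ = 0 := by rw [real_inner_comm, hB]
  subst hA' hB'
  rw [dirForm]
  simp only [inner_add_left, inner_add_right, real_inner_smul_left, real_inner_smul_right,
    real_inner_self_eq_norm_sq, hA, hB, hB2]
  field_simp
  ring

lemma norm_rpow_two_mul {E : Type*} [NormedAddCommGroup E] (x : E) (α : ℝ) :
    ‖x‖ ^ (2 * α) = (‖x‖ ^ 2) ^ α := by
  rw [Real.rpow_mul (norm_nonneg x), Real.rpow_two]

/-- A linear map which is `g`-conformal with factor `μ` and respects the splitting scales the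
direction form. -/
lemma dirForm_map {α : ℝ} (hα : 0 < α) {z z' : GVec p q} (hz : z.1 ≠ 0) (hz' : z'.1 ≠ 0)
    (L : GVec p q →L[ℝ] GVec p q) {μ : ℝ}
    (hconf : ∀ U V, gMet α p q z'.1 (L U) (L V) = μ * gMet α p q z.1 U V)
    (hS : ∀ U ∈ TSp p q z, L U ∈ TSp p q z') (hH : ∀ U ∈ THp p q z, L U ∈ THp p q z')
    (U V : GVec p q) :
    dirForm z'.1 (L U).1 (L V).1 = μ * ((‖z.1‖ ^ 2) ^ α * ‖z.1‖ ^ 2) /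
      ((‖z'.1‖ ^ 2) ^ α * ‖z'.1‖ ^ 2) * dirForm z.1 U.1 V.1 := by
  have hn := norm_ne_zero_iff.2 hz
  have hn' := norm_ne_zero_iff.2 hz'
  have hP : ∀ U : GVec p q, projS p q z U ∈ TSp p q z := fun U => ⟨rfl, inner_proj_self hz U.1⟩
  have hdec : ∀ U : GVec p q, ∃ t : ℝ, (L U).1 = (L (projS p q z U)).1 + t • z'.1 := fun U => by
    obtain ⟨t, ht⟩ := hH (U - projS p q z U) ⟨⟪U.1, z.1⟫ / ‖z.1‖ ^ 2, by simp [projS]⟩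
    refine ⟨t, ?_⟩
    rw [← ht, map_sub]
    simp
  obtain ⟨s, hs⟩ := hdec U
  obtain ⟨t, ht⟩ := hdec V
  have hc := hconf (projS p q z U) (projS p q z V)
  have hU := hS _ (hP U)
  have hV := hS _ (hP V)
  rw [dirForm_eq_inner_of_perp hz' hU.2 hV.2 hs ht, dirForm_eq_inner_of_perp hz (hP U).2 (hP V).2
    (s := ⟪U.1, z.1⟫ / ‖z.1‖ ^ 2) (t := ⟪V.1, z.1⟫ / ‖z.1‖ ^ 2) (by simp [projS])
    (by simp [projS])]
  rw [gMet, gMet, hU.1, (hP U).1, norm_rpow_two_mul, norm_rpow_two_mul] at hc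
  simp only [inner_zero_left, add_zero] at hc
  have h1 : (α + 1) ≠ 0 := by positivity
  have h2 : (‖z'.1‖ ^ 2) ^ α ≠ 0 := by positivity
  have h3 : (‖z'.1‖ ^ 2) ^ α * ⟪(L (projS p q z U)).1, (L (projS p q z V)).1⟫ =
      μ * ((‖z.1‖ ^ 2) ^ α * ⟪(projS p q z U).1, (projS p q z V).1⟫) := by
    have : (α + 1) ^ 2 ≠ 0 := pow_ne_zero 2 h1
    apply mul_left_cancel₀ this
    linarith
  field_simp
  linarith

end Pullback

section Constancy

variable {E F : Type*} [NormedAddCommGroup E] [InnerProductSpace ℝ E]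
  [NormedAddCommGroup F] [NormedSpace ℝ F] {S : Set (E × F)}

lemma fderiv_norm_sq_of_horizontal {E' : Type*} [NormedAddCommGroup E'] [InnerProductSpace ℝ E']
    (hS : IsOpen S) {m : E × F → E'}
    (hm : ContDiffOn ℝ ∞ m S) (t : ℝ) (w : F)
    (hinv : ∀ z ∈ S, fderiv ℝ m z (t • z.1, w) = 0) {z : E × F} (hz : z ∈ S) (b : E) :
    fderiv ℝ (fun z => ⟪fderiv ℝ m z (b, 0), fderiv ℝ m z (b, 0)⟫) z (t • z.1, w) =
      - 2 * t * ⟪fderiv ℝ m z (b, 0), fderiv ℝ m z (b, 0)⟫ := by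
  have h1 := contDiffOn_fderiv_apply hS hm (b, 0)
  have h := fderiv_fderiv_of_invariant hS hm
    (t • (ContinuousLinearMap.inl ℝ E F ∘L ContinuousLinearMap.fst ℝ E F)) (0, w)
    (fun z hz => by simpa using hinv z hz) hz (b, 0)
  simp only [smul_apply, ContinuousLinearMap.comp_apply,
    ContinuousLinearMap.coe_fst', ContinuousLinearMap.inl_apply, Prod.smul_mk, smul_zero,
    Prod.mk_add_mk, add_zero, zero_add] at h
  rw [fderiv_inner_of_isOpen hS h1 h1 hz, h]
  rw [show ((t • b, 0) : E × F) = t • (b, 0) by simp, map_smul, inner_neg_left, inner_neg_right,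
    real_inner_smul_left, real_inner_smul_right]
  ring

/-- The factor by which `m` scales the direction form is constant in horizontal directions. -/
lemma fderiv_factor_horizontal (hS : IsOpen S) (hS0 : ∀ z ∈ S, z.1 ≠ 0) {m : E × F → E}
    (hm : ContDiffOn ℝ ∞ m S) {c : E × F → ℝ}
    (hK : ∀ z ∈ S, ∀ A B, ⟪fderiv ℝ m z A, fderiv ℝ m z B⟫ = c z * dirForm z.1 A.1 B.1)
    {z : E × F} (hz : z ∈ S) (hc : DifferentiableAt ℝ c z)
    {b : E} (hbb : ⟪b, b⟫ = 1) (hb : ⟪b, z.1⟫ = 0) (t : ℝ) (w : F) :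
    fderiv ℝ c z (t • z.1, w) = 0 := by
  have hfst : ContDiffOn ℝ ∞ (fun z : E × F => z.1) S := contDiff_fst.contDiffOn
  have hrad : ∀ z : E × F, z ∈ S → dirForm z.1 (t • z.1) (t • z.1) = 0 := fun z hz => by
    rw [dirForm_eq_inner_of_perp (A := 0) (B := 0) (s := t) (t := t) (hS0 z hz)] <;> simp
  have hν : ∀ z ∈ S, ∀ A B : E × F, ⟪fderiv ℝ (fun z : E × F => unitDir z.1) z A,
      fderiv ℝ (fun z : E × F => unitDir z.1) z B⟫ = dirForm z.1 A.1 B.1 := fun z hz A B => by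
    rw [inner_fderiv_unitDir_comp differentiableAt_fst (hS0 z hz)]; simp [fderiv_fst]
  have h1 := fderiv_norm_sq_of_horizontal hS hm t w (fun z hz => by
    rw [← inner_self_eq_zero (𝕜 := ℝ), hK z hz, hrad z hz, mul_zero]) hz b
  have h2 := fderiv_norm_sq_of_horizontal hS (hfst.unitDir hS0) t w (fun z hz => by
    rw [← inner_self_eq_zero (𝕜 := ℝ), hν z hz, hrad z hz]) hz b
  have hd : DifferentiableAt ℝ (fun z : E × F => dirForm z.1 b b) z :=
    (fderiv_dirForm (hS0 z hz) b b 0).1.comp z differentiableAt_fst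
  rw [fderiv_congr_of_isOpen hS (fun z hz => hK z hz _ _) hz, hK z hz, fderiv_fun_mul hc hd] at h1
  rw [fderiv_congr_of_isOpen hS (fun z hz => hν z hz _ _) hz, hν z hz] at h2
  have hk : dirForm z.1 b b ≠ 0 := by
    have := norm_ne_zero_iff.2 (hS0 z hz)
    rw [dirForm, hbb, hb]
    simpa
  simp only [add_apply, smul_apply, smul_eq_mul, h2] at h1
  have h3 : dirForm z.1 b b * fderiv ℝ c z (t • z.1, w) = 0 := by linarith
  exact (mul_eq_zero.1 h3).resolve_left hk

end Constancy

section Vertical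

variable {p q : ℕ}

/-- The squared homothety factor between the direction forms at `z` and `f z`. -/
def directionFactor (α : ℝ) (p q : ℕ) (f : GVec p q → GVec p q) (u : GVec p q → ℝ)
    (z : GVec p q) : ℝ :=
  (u z ^ 2)⁻¹ * ((‖z.1‖ ^ 2) ^ α * ‖z.1‖ ^ 2) / ((‖(f z).1‖ ^ 2) ^ α * ‖(f z).1‖ ^ 2)

lemma fderiv_fst_comp {f : GVec p q → GVec p q} {z : GVec p q} (hf : DifferentiableAt ℝ f z)
    (U : GVec p q) : fderiv ℝ (fun z => (f z).1) z U = (fderiv ℝ f z U).1 := by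
  rw [fderiv.fst hf]; rfl

lemma fderiv_snd_comp {f : GVec p q → GVec p q} {z : GVec p q} (hf : DifferentiableAt ℝ f z)
    (U : GVec p q) : fderiv ℝ (fun z => (f z).2) z U = (fderiv ℝ f z U).2 := by
  rw [fderiv.snd hf]; rfl

/-- The direction factor in terms of `|f.1|²`, `∂_w |f.1|²`, `∂_w f.2` and `|x|²`. -/
def directionFactorForm {F : Type*} [NormedAddCommGroup F] (α : ℝ) (y : ℝ × ℝ × F × ℝ) : ℝ :=
  ((α + 1) ^ 2 * y.1 ^ α * y.2.1 ^ 2 / (4 * y.1) + ‖y.2.2.1‖ ^ 2) * (y.2.2.2 ^ α * y.2.2.2) /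
    (y.1 ^ α * y.1)

lemma differentiableAt_directionFactorForm {F : Type*} [NormedAddCommGroup F]
    [InnerProductSpace ℝ F] (α : ℝ) {y : ℝ × ℝ × F × ℝ} (h1 : 0 < y.1) (h2 : 0 < y.2.2.2) :
    DifferentiableAt ℝ (directionFactorForm α) y := by
  have d1 : DifferentiableAt ℝ (fun y : ℝ × ℝ × F × ℝ => y.1) y := differentiableAt_fst
  have d2 : DifferentiableAt ℝ (fun y : ℝ × ℝ × F × ℝ => y.2.1) y := by fun_prop
  have d3 : DifferentiableAt ℝ (fun y : ℝ × ℝ × F × ℝ => y.2.2.1) y := by fun_prop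
  have d4 : DifferentiableAt ℝ (fun y : ℝ × ℝ × F × ℝ => y.2.2.2) y := by fun_prop
  have r1 := d1.rpow_const (p := α) (Or.inl h1.ne')
  have r4 := d4.rpow_const (p := α) (Or.inl h2.ne')
  have i1 := ((d1.const_mul 4).hasFDerivAt.inv_real (by positivity)).differentiableAt
  have i2 := ((r1.mul d1).hasFDerivAt.inv_real
    (mul_pos (Real.rpow_pos_of_pos h1 α) h1).ne').differentiableAt
  unfold directionFactorForm
  simp only [div_eq_mul_inv]
  exact (((((r1.const_mul _).mul (d2.pow 2)).mul i1).add (d3.norm_sq ℝ)).mul (r4.mul d4)).mul i2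

lemma fderiv_directionFactor_vertical {α : ℝ} {Ω : Set (GVec p q)}
    (hΩ : Ω ⊆ GM0 p q) (hΩo : IsOpen Ω)
    {f : GVec p q → GVec p q} (hmaps : Set.MapsTo f Ω (GM0 p q))
    (hf : ContDiffOn ℝ (⊤ : ℕ∞) f Ω) {u : GVec p q → ℝ}
    (hconf : ∀ z ∈ Ω, ∀ U V : GVec p q,
      gMet α p q (f z).1 (fderiv ℝ f z U) (fderiv ℝ f z V) = (u z ^ 2)⁻¹ * gMet α p q z.1 U V)
    (hvert : ∀ z ∈ Ω, ∀ U ∈ TSp p q z, fderiv ℝ f z U ∈ TSp p q (f z))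
    (hhor : ∀ z ∈ Ω, ∀ U ∈ THp p q z, fderiv ℝ f z U ∈ THp p q (f z))
    {w : EuclideanSpace ℝ (Fin q)} (hw : ⟪w, w⟫ = 1) {z : GVec p q} (hz : z ∈ Ω) :
    DifferentiableAt ℝ (directionFactor α p q f u) z ∧ ∀ v : EuclideanSpace ℝ (Fin p),
      ⟪v, z.1⟫ = 0 → fderiv ℝ (directionFactor α p q f u) z (v, 0) = 0 := by
  have hfd : ∀ z ∈ Ω, DifferentiableAt ℝ f z := fun z hz => hf.differentiableAt_of_isOpen hΩo hz
  set a : GVec p q → ℝ := fun z => ⟪(f z).1, (f z).1⟫ with ha_def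
  have ha : ContDiffOn ℝ ∞ a Ω := hf.fst.inner ℝ hf.fst
  have hda : ∀ z ∈ Ω, ∀ U, fderiv ℝ a z U = 2 * ⟪(f z).1, (fderiv ℝ f z U).1⟫ := fun z hz U => by
    rw [ha_def, fderiv_inner_of_isOpen hΩo hf.fst hf.fst hz, fderiv_fst_comp (hfd z hz),
      real_inner_comm (f z).1]
    ring
  set b : GVec p q → EuclideanSpace ℝ (Fin q) := fun z => (f z).2 with hb_def
  have hb : ContDiffOn ℝ ∞ b Ω := hf.snd
  have hdb : ∀ z ∈ Ω, ∀ U, fderiv ℝ b z U = (fderiv ℝ f z U).2 := fun z hz U =>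
    fderiv_snd_comp (hfd z hz) U
  set W : GVec p q := (0, w) with hW
  set h : GVec p q → ℝ × ℝ × EuclideanSpace ℝ (Fin q) × ℝ := fun z =>
    (a z, fderiv ℝ a z W, fderiv ℝ b z W, ⟪z.1, z.1⟫) with hh
  have hca : ∀ z, a z = ‖(f z).1‖ ^ 2 := fun z => real_inner_self_eq_norm_sq _
  have hfst : ContDiffOn ℝ ∞ (fun z : GVec p q => z.1) Ω := contDiff_fst.contDiffOn
  have hform : ∀ z ∈ Ω, directionFactor α p q f u z = directionFactorForm α (h z) := fun z hz => by
    have hn' := norm_ne_zero_iff.2 (hmaps hz)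
    have hc := hconf z hz W W
    obtain ⟨t, ht⟩ := hhor z hz W ⟨0, by simp [hW]⟩
    simp only [gMet, norm_rpow_two_mul, hW, inner_zero_left, mul_zero, zero_add, hw, mul_one] at hc
    rw [directionFactor, directionFactorForm, ← hc]
    simp only [hh, hda z hz, hdb z hz, hca, ← hW, ht, real_inner_smul_right,
      real_inner_self_eq_norm_sq, norm_smul, mul_pow, Real.norm_eq_abs, sq_abs]
    congr 2
    field_simp
    ring
  have hhd : DifferentiableAt ℝ h z :=
    (ha.differentiableAt_of_isOpen hΩo hz).prodMk
    (((contDiffOn_fderiv_apply hΩo ha W).differentiableAt_of_isOpen hΩo hz).prodMk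
    (((contDiffOn_fderiv_apply hΩo hb W).differentiableAt_of_isOpen hΩo hz).prodMk
    ((hfst.inner ℝ hfst).differentiableAt_of_isOpen hΩo hz)))
  have hΦ : DifferentiableAt ℝ (directionFactorForm α) (h z) :=
    differentiableAt_directionFactorForm α (real_inner_self_pos.2 (hmaps hz))
      (real_inner_self_pos.2 (hΩ hz))
  have hev : directionFactor α p q f u =ᶠ[nhds z] directionFactorForm α ∘ h :=
    Filter.eventuallyEq_of_mem (hΩo.mem_nhds hz) hform
  refine ⟨(hΦ.comp z hhd).congr_of_eventuallyEq hev, fun v hv => ?_⟩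
  rw [hev.fderiv_eq, fderiv_comp z hΦ hhd, ContinuousLinearMap.comp_apply]
  suffices fderiv ℝ h z (v, 0) = 0 by rw [this, map_zero]
  have hn := norm_ne_zero_iff.2 (hΩ hz)
  have hv' : ⟪z.1, v⟫ = 0 := by rw [real_inner_comm, hv]
  -- an infinitesimal rotation with value `v` at `z.1`
  set A : EuclideanSpace ℝ (Fin p) →L[ℝ] EuclideanSpace ℝ (Fin p) :=
    (‖z.1‖ ^ 2)⁻¹ • ((innerSL ℝ z.1).smulRight v - (innerSL ℝ v).smulRight z.1) with hA
  set T : GVec p q →L[ℝ] GVec p q := ContinuousLinearMap.inl ℝ _ _ ∘L A ∘L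
    ContinuousLinearMap.fst ℝ _ _ with hT
  have hAv : A z.1 = v := by simp [hA, hv, smul_smul, hn]
  have hTz : T z + 0 = (v, 0) := by simp [hT, hAv]
  have hTS : ∀ y, T y + 0 ∈ TSp p q y := fun y => by
    refine ⟨by simp [hT], ?_⟩
    simp [hT, hA, inner_sub_left, real_inner_smul_left]
    right
    ring
  have hTW : T W = 0 := by simp [hT, hW]
  have hai : ∀ y ∈ Ω, fderiv ℝ a y (T y + 0) = 0 := fun y hy => by
    rw [hda y hy, real_inner_comm, (hvert y hy _ (hTS y)).2, mul_zero]
  have hbi : ∀ y ∈ Ω, fderiv ℝ b y (T y + 0) = 0 := fun y hy => by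
    rw [hdb y hy, (hvert y hy _ (hTS y)).1]
  have e1 := hai z hz
  have e2 := fderiv_fderiv_of_invariant hΩo ha T 0 hai hz W
  have e3 := fderiv_fderiv_of_invariant hΩo hb T 0 hbi hz W
  have e4 := fderiv_inner_of_isOpen hΩo hfst hfst hz (v, 0)
  rw [hTW, map_zero, neg_zero, hTz] at e2 e3
  rw [hTz] at e1
  have e5 : fderiv ℝ (fun z : GVec p q => ⟪z.1, z.1⟫) z (v, 0) = 0 := by
    rw [e4, fderiv_fst]; simp [hv, hv']
  rw [hh, DifferentiableAt.fderiv_prodMk (ha.differentiableAt_of_isOpen hΩo hz)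
    (((contDiffOn_fderiv_apply hΩo ha W).differentiableAt_of_isOpen hΩo hz).prodMk
    (((contDiffOn_fderiv_apply hΩo hb W).differentiableAt_of_isOpen hΩo hz).prodMk
    ((hfst.inner ℝ hfst).differentiableAt_of_isOpen hΩo hz))),
    DifferentiableAt.fderiv_prodMk ((contDiffOn_fderiv_apply hΩo ha W).differentiableAt_of_isOpen hΩo hz)
    (((contDiffOn_fderiv_apply hΩo hb W).differentiableAt_of_isOpen hΩo hz).prodMk
    ((hfst.inner ℝ hfst).differentiableAt_of_isOpen hΩo hz)),
    DifferentiableAt.fderiv_prodMk ((contDiffOn_fderiv_apply hΩo hb W).differentiableAt_of_isOpen hΩo hz)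
    ((hfst.inner ℝ hfst).differentiableAt_of_isOpen hΩo hz)]
  simp only [ContinuousLinearMap.prod_apply, e1, e2, e3, e5]
  rfl

end Vertical

section Ricci

variable {α : ℝ} {p q : ℕ}

lemma norm_rpow_neg_two (x : EuclideanSpace ℝ (Fin p)) : ‖x‖ ^ (-(2:ℝ)) = (‖x‖ ^ 2)⁻¹ := by
  rw [Real.rpow_neg (norm_nonneg x), Real.rpow_two]

lemma fderiv_gammaMap {z : GVec p q} (hz : z.1 ≠ 0) (Y Z X : GVec p q) :
    fderiv ℝ (fun w : GVec p q => gammaMap α p q w.1 Y Z) z X =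
      ((α * (‖z.1‖ ^ 2)⁻¹) • (⟪X.1, Z.1⟫ • Y.1 + ⟪X.1, Y.1⟫ • Z.1 - ⟪Y.1, Z.1⟫ • X.1) -
        (2 * α * ⟪z.1, X.1⟫ * ((‖z.1‖ ^ 2) ^ 2)⁻¹) •
          (⟪z.1, Z.1⟫ • Y.1 + ⟪z.1, Y.1⟫ • Z.1 - ⟪Y.1, Z.1⟫ • z.1), 0) := by
  have hn := norm_ne_zero_iff.2 hz
  have hx : HasFDerivAt (fun w : GVec p q => w.1) (ContinuousLinearMap.fst ℝ _ _) z :=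
    hasFDerivAt_fst
  have hs := (hx.norm_sq.inv_real (pow_ne_zero 2 hn)).const_mul α
  have hZ := (hx.inner ℝ (hasFDerivAt_const Z.1 z)).smul (hasFDerivAt_const Y.1 z)
  have hY := (hx.inner ℝ (hasFDerivAt_const Y.1 z)).smul (hasFDerivAt_const Z.1 z)
  have hv := (hZ.add hY).sub (hx.const_smul ⟪Y.1, Z.1⟫)
  have h := (hs.smul hv).prodMk (hasFDerivAt_const (0 : EuclideanSpace ℝ (Fin q)) z)
  have hfun : (fun w : GVec p q => gammaMap α p q w.1 Y Z) = fun w =>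
      ((α * (‖w.1‖ ^ 2)⁻¹) • (⟪w.1, Z.1⟫ • Y.1 + ⟪w.1, Y.1⟫ • Z.1 - ⟪Y.1, Z.1⟫ • w.1), 0) := by
    ext1 w; rw [gammaMap, norm_rpow_neg_two]
  rw [hfun]
  refine (congrArg (fun L => L X) h.fderiv).trans ?_
  simp
  module

lemma curvOp_eq {z : GVec p q} (hz : z.1 ≠ 0) (X Y Z : GVec p q) :
    curvOp α p q z X Y Z = (-(α ^ 2 + 2 * α)) •
      (dirForm z.1 Y.1 Z.1 • projS p q z X - dirForm z.1 X.1 Z.1 • projS p q z Y) := by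
  have hn := norm_ne_zero_iff.2 hz
  simp only [curvOp, covDeriv, fderiv_gammaMap hz]
  simp only [gammaMap, norm_rpow_neg_two, projS, dirForm, Prod.mk_add_mk, Prod.mk_sub_mk,
    Prod.smul_mk, inner_add_right, inner_sub_right, real_inner_smul_right,
    real_inner_self_eq_norm_sq, real_inner_comm z.1, real_inner_comm X.1 Y.1, smul_zero, sub_zero, add_zero]
  rw [Prod.mk.injEq]
  refine ⟨?_, rfl⟩
  match_scalars <;> field_simp <;> ring

lemma ricci_eq {z : GVec p q} (hz : z.1 ≠ 0) (X Y : GVec p q) :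
    ricci α p q z X Y = (-(α ^ 2 + 2 * α) * (p - 2)) * dirForm z.1 X.1 Y.1 := by
  have hn := norm_ne_zero_iff.2 hz
  have hsum : ∀ A B : EuclideanSpace ℝ (Fin p), ∑ i, A i * B i = ⟪A, B⟫ := fun A B => by
    simp [PiLp.inner_apply, mul_comm]
  obtain ⟨x, y⟩ := z
  obtain ⟨A, A'⟩ := X
  obtain ⟨B, B'⟩ := Y
  have hterm : ∀ i : Fin p, (curvOp α p q (x, y) (EuclideanSpace.single i 1, 0) (B, B') (A, A')).1 i =
      (α ^ 2 + 2 * α) * (-dirForm x B A + dirForm x B A / ‖x‖ ^ 2 * (x i * x i)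
        + (‖x‖ ^ 2)⁻¹ * (A i * B i) - ⟪A, x⟫ / (‖x‖ ^ 2) ^ 2 * (x i * B i)
        - ⟪B, x⟫ / (‖x‖ ^ 2) ^ 2 * (A i * x i)
        + ⟪A, x⟫ * ⟪B, x⟫ / (‖x‖ ^ 2) ^ 3 * (x i * x i)) :=
    fun i => by
    rw [curvOp_eq hz]
    have hsingle : ∀ C : EuclideanSpace ℝ (Fin p), ⟪EuclideanSpace.single i (1 : ℝ), C⟫ = C i :=
      fun C => by rw [EuclideanSpace.inner_single_left]; simp
    simp [projS, dirForm, hsingle]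
    field_simp
    ring
  have hzero : ∀ i : Fin q, (curvOp α p q (x, y) (0, EuclideanSpace.single i 1) (B, B') (A, A')).2 i = 0 :=
    fun i => by rw [curvOp_eq hz]; simp [projS]
  simp only [ricci, hterm, hzero, ← Finset.mul_sum, Finset.sum_add_distrib, Finset.sum_sub_distrib,
    hsum, Finset.sum_const_zero, Finset.sum_const, Finset.card_univ, Fintype.card_fin, nsmul_eq_mul,
    real_inner_self_eq_norm_sq, real_inner_comm B x, dirForm, real_inner_comm A B]
  simp at hn
  field_simp
  ring

end Ricci

lemma exists_orthonormal_pair_perp {p : ℕ} (hp : 3 ≤ p) {x : EuclideanSpace ℝ (Fin p)}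
    (hx : x ≠ 0) : ∃ a b : EuclideanSpace ℝ (Fin p),
      ⟪a, a⟫ = 1 ∧ ⟪b, b⟫ = 1 ∧ ⟪a, b⟫ = 0 ∧ ⟪a, x⟫ = 0 ∧ ⟪b, x⟫ = 0 := by
  have : Fact (Module.finrank ℝ (EuclideanSpace ℝ (Fin p)) = (p - 1) + 1) :=
    ⟨by rw [finrank_euclideanSpace_fin]; omega⟩
  have hr : Module.finrank ℝ (ℝ ∙ x)ᗮ = p - 1 := Submodule.finrank_orthogonal_span_singleton hx
  set e := stdOrthonormalBasis ℝ (ℝ ∙ x)ᗮ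
  have hperp : ∀ i, ⟪((e i : (ℝ ∙ x)ᗮ) : EuclideanSpace ℝ (Fin p)), x⟫ = 0 := fun i =>
    Submodule.mem_orthogonal_singleton_iff_inner_left.1 (e i).2
  have hself : ∀ i, ⟪((e i : (ℝ ∙ x)ᗮ) : EuclideanSpace ℝ (Fin p)),
      (e i : EuclideanSpace ℝ (Fin p))⟫ = 1 := fun i => by
    have := e.orthonormal.1 i
    rw [real_inner_self_eq_norm_sq, Submodule.norm_coe, this, one_pow]
  refine ⟨e ⟨0, by omega⟩, e ⟨1, by omega⟩, hself _, hself _, ?_, hperp _, hperp _⟩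
  exact e.orthonormal.2 (by simp)

lemma directionFactor_eq_one
    (α : ℝ) (hα : 0 < α) (p q : ℕ) (hp : 3 ≤ p) (hq : 1 ≤ q)
    (Ω : Set (GVec p q)) (hΩ : Ω ⊆ GM0 p q) (hΩo : IsOpen Ω)
    (f : GVec p q → GVec p q) (hmaps : Set.MapsTo f Ω (GM0 p q))
    (hf : ContDiffOn ℝ (⊤ : ℕ∞) f Ω)
    (u : GVec p q → ℝ) (hu : ∀ z ∈ Ω, 0 < u z)
    (hconf : ∀ z ∈ Ω, ∀ U V : GVec p q,
      gMet α p q (f z).1 (fderiv ℝ f z U) (fderiv ℝ f z V) = (u z ^ 2)⁻¹ * gMet α p q z.1 U V)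
    (hsplit : ∀ z ∈ Ω, ⇑(fderiv ℝ f z) '' TSp p q z = TSp p q (f z) ∧
      ⇑(fderiv ℝ f z) '' THp p q z = THp p q (f z)) :
    ∀ z ∈ Ω, directionFactor α p q f u z = 1 := by
  intro z hz
  have hvert : ∀ z ∈ Ω, ∀ U ∈ TSp p q z, fderiv ℝ f z U ∈ TSp p q (f z) := fun z hz U hU =>
    (hsplit z hz).1 ▸ Set.mem_image_of_mem _ hU
  have hhor : ∀ z ∈ Ω, ∀ U ∈ THp p q z, fderiv ℝ f z U ∈ THp p q (f z) := fun z hz U hU =>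
    (hsplit z hz).2 ▸ Set.mem_image_of_mem _ hU
  have hfd : ∀ z ∈ Ω, DifferentiableAt ℝ f z := fun z hz => hf.differentiableAt_of_isOpen hΩo hz
  set c := directionFactor α p q f u with hc
  set m : GVec p q → EuclideanSpace ℝ (Fin p) := fun z => unitDir (f z).1 with hm_def
  have hm : ContDiffOn ℝ ∞ m Ω := hf.fst.unitDir fun z hz => hmaps hz
  have hK : ∀ z ∈ Ω, ∀ A B, ⟪fderiv ℝ m z A, fderiv ℝ m z B⟫ = c z * dirForm z.1 A.1 B.1 :=
    fun z hz A B => by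
    rw [hm_def, inner_fderiv_unitDir_comp (hfd z hz).fst (hmaps hz), fderiv_fst_comp (hfd z hz),
      fderiv_fst_comp (hfd z hz)]
    exact dirForm_map hα (hΩ hz) (hmaps hz) (fderiv ℝ f z) (hconf z hz) (hvert z hz) (hhor z hz) A B
  have hw : ⟪EuclideanSpace.single (⟨0, hq⟩ : Fin q) (1 : ℝ), EuclideanSpace.single ⟨0, hq⟩ 1⟫ = 1 := by
    rw [real_inner_self_eq_norm_sq]; simp
  have hvc := fun {z} hz => fderiv_directionFactor_vertical hΩ hΩo hmaps hf hconf hvert hhor hw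
    (z := z) hz
  have hdc : ∀ z ∈ Ω, fderiv ℝ c z = 0 := fun z hz => by
    obtain ⟨a, -, haa, -, -, ha, -⟩ := exists_orthonormal_pair_perp hp (hΩ hz)
    refine ContinuousLinearMap.ext fun U => ?_
    have h1 := (hvc hz).2 _ (inner_proj_self (hΩ hz) U.1)
    have h2 := fderiv_factor_horizontal hΩo (fun z hz => hΩ hz) hm hK hz (hvc hz).1 haa ha
      (⟪U.1, z.1⟫ / ‖z.1‖ ^ 2) U.2
    have hU : U = (U.1 - (⟪U.1, z.1⟫ / ‖z.1‖ ^ 2) • z.1, 0) +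
      ((⟪U.1, z.1⟫ / ‖z.1‖ ^ 2) • z.1, U.2) := by simp
    rw [hU, map_add, h2, h1, add_zero]
    rfl
  obtain ⟨r, hr, hball⟩ := Metric.isOpen_iff.1 hΩo z hz
  have hconst : ∀ y ∈ Metric.ball z r, c y = c z := fun y hy =>
    Metric.isOpen_ball.is_const_of_fderiv_eq_zero (𝕜 := ℝ)
      (convex_ball z r).isPreconnected
      (fun y hy => (hvc (hball hy)).1.differentiableWithinAt)
      (fun y hy => hdc y (hball hy)) hy (Metric.mem_ball_self hr)
  obtain ⟨a, b, haa, hbb, hab, ha, hb⟩ := exists_orthonormal_pair_perp hp (hΩ hz)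
  have hcpos : 0 < c z := by
    have h1 : 0 < ‖z.1‖ := norm_pos_iff.2 (hΩ hz)
    have h2 : 0 < ‖(f z).1‖ := norm_pos_iff.2 (hmaps hz)
    have h3 := hu z hz
    rw [hc, directionFactor]
    positivity
  refine homothety_const_eq_one Metric.isOpen_ball (fun y hy => hΩ (hball hy)) (hm.mono hball)
    (fun y hy => inner_unitDir_self (hmaps (hball hy))) hcpos.ne'
    (fun y hy A B => by rw [hK y (hball hy), hconst y hy]) (Metric.mem_ball_self hr)
    (fun v hv => ?_) haa hbb hab ha hb
  have hn := norm_ne_zero_iff.2 (hmaps hz)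
  have hv' : ⟪v, (f z).1⟫ = 0 := by
    have hv₂ : ⟪v, unitDir (f z).1⟫ = 0 := hv
    rw [unitDir, real_inner_smul_right] at hv₂
    exact (mul_eq_zero.1 hv₂).resolve_left (inv_ne_zero hn)
  obtain ⟨A, -, hA⟩ : (‖(f z).1‖ • v, 0) ∈ fderiv ℝ f z '' TSp p q z := by
    rw [(hsplit z hz).1]
    exact ⟨rfl, by rw [real_inner_smul_left, hv', mul_zero]⟩
  refine ⟨A, ?_⟩
  rw [hm_def, fderiv_unitDir_comp (hfd z hz).fst (hmaps hz), fderiv_fst_comp (hfd z hz), hA]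
  simp [real_inner_smul_right, real_inner_comm, hv', smul_smul, hn]

/-- a conformal diffeomorphism preserving the vertical/horizontal splitting
preserves the Ricci tensor of `g`. -/
theorem grushin_conformal_preserves_ricci
    (α : ℝ) (hα : 0 < α) (p q : ℕ) (hp : 3 ≤ p) (hq : 1 ≤ q)
    (Ω : Set (GVec p q)) (hΩ : Ω ⊆ GM0 p q) (hΩo : IsOpen Ω)
    (f : GVec p q → GVec p q) (hmaps : Set.MapsTo f Ω (GM0 p q))
    (hf : ContDiffOn ℝ (⊤ : ℕ∞) f Ω) (hinj : Set.InjOn f Ω)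
    (u : GVec p q → ℝ) (hu : ∀ z ∈ Ω, 0 < u z)
    (hconf : ∀ z ∈ Ω, ∀ U V : GVec p q,
      gMet α p q (f z).1 (fderiv ℝ f z U) (fderiv ℝ f z V) = (u z ^ 2)⁻¹ * gMet α p q z.1 U V)
    (hsplit : ∀ z ∈ Ω, ⇑(fderiv ℝ f z) '' TSp p q z = TSp p q (f z) ∧
      ⇑(fderiv ℝ f z) '' THp p q z = THp p q (f z)) :
    ∀ z ∈ Ω, ∀ U V : GVec p q,
      ricci α p q (f z) (fderiv ℝ f z U) (fderiv ℝ f z V) = ricci α p q z U V := by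
  intro z hz U V
  have hone := directionFactor_eq_one α hα p q hp hq Ω hΩ hΩo f hmaps hf u hu hconf hsplit z hz
  rw [ricci_eq (hmaps hz), ricci_eq (hΩ hz), dirForm_map hα (hΩ hz) (hmaps hz) (fderiv ℝ f z)
    (hconf z hz) (fun U hU => (hsplit z hz).1 ▸ Set.mem_image_of_mem _ hU)
    (fun U hU => (hsplit z hz).2 ▸ Set.mem_image_of_mem _ hU)]
  rw [directionFactor] at hone
  rw [hone, one_mul]

end
end

section
/- Let p ≥ 3 and q ≥ 1, and let Ω ⊂ M₀ be a connected open set. Let f : Ω → f(Ω) ⊂ M₀ be a smooth diffeomorphism which is conformal with respect to g with conformal factor u. Then either u is constant, or there exist a > 0 and b ∈ ℝ^q such that u(x, y) = a(|x|^{2(α+1)} + |y − b|²) = a ‖(x, y−b)‖^{2(α+1)} for all (x,y) ∈ Ω. -/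
noncomputable section

open scoped RealInnerProductSpace

open scoped Topology

set_option linter.unusedSectionVars false

section Abstract

variable {E : Type*} [NormedAddCommGroup E] [NormedSpace ℝ E]

/-- `Γ` is the Levi-Civita connection (in coordinates) of the Riemannian metric `G` on `M`. -/
structure IsLeviCivita (M : Set E) (G : E → E →L[ℝ] E →L[ℝ] ℝ)
    (Γ : E → E →L[ℝ] E →L[ℝ] E) : Prop where
  symm : ∀ z ∈ M, ∀ U V, G z U V = G z V U
  pos : ∀ z ∈ M, ∀ U, U ≠ 0 → 0 < G z U U
  diff : ∀ z ∈ M, DifferentiableAt ℝ G z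
  torsion_free : ∀ z ∈ M, ∀ U V, Γ z U V = Γ z V U
  diff_conn : ∀ z ∈ M, DifferentiableAt ℝ Γ z
  compat : ∀ z ∈ M, ∀ W U V, fderiv ℝ G z W U V = G z (Γ z W U) V + G z U (Γ z W V)

/-- The Christoffel symbols of `exp (-2 L) • G`, where `n` is the gradient of `L`. -/
def confConn (G : E → E →L[ℝ] E →L[ℝ] ℝ) (Γ : E → E →L[ℝ] E →L[ℝ] E) (L : E → ℝ) (n : E → E)
    (z X Y : E) : E :=
  Γ z X Y - fderiv ℝ L z X • Y - fderiv ℝ L z Y • X + G z X Y • n z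

/-- The curvature `R(X,Y)Z` of a connection given by its Christoffel symbols. -/
def connCurv (Γ : E → E → E → E) (z X Y Z : E) : E :=
  fderiv ℝ (fun w => Γ w Y Z) z X - fderiv ℝ (fun w => Γ w X Z) z Y
    + Γ z X (Γ z Y Z) - Γ z Y (Γ z X Z)

variable {M : Set E} {G : E → E →L[ℝ] E →L[ℝ] ℝ} {Γ : E → E →L[ℝ] E →L[ℝ] E}

lemma IsLeviCivita.eq_of_forall (h : IsLeviCivita M G Γ) {z : E} (hz : z ∈ M) {v w : E}
    (hvw : ∀ U, G z v U = G z w U) : v = w := by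
  by_contra hne
  have := h.pos z hz (v - w) (sub_ne_zero.2 hne)
  simp [hvw] at this

lemma hasFDerivAt_fderiv_apply {f : E → E} {z : E} (hf : ContDiffAt ℝ 2 f z) (Y : E) :
    HasFDerivAt (fun w => fderiv ℝ f w Y) ((fderiv ℝ (fderiv ℝ f) z).flip Y) z := by
  have h1 : DifferentiableAt ℝ (fderiv ℝ f) z :=
    (hf.fderiv_right (m := 1) (by norm_num)).differentiableAt (by norm_num)
  have := h1.hasFDerivAt.clm_apply (hasFDerivAt_const Y z)
  convert this using 1
  ext; simp

lemma symm_fderiv_fderiv {F : Type*} [NormedAddCommGroup F] [NormedSpace ℝ F]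
    {f : E → F} {z : E} (hf : ContDiffAt ℝ 2 f z) (X Y : E) :
    fderiv ℝ (fderiv ℝ f) z X Y = fderiv ℝ (fderiv ℝ f) z Y X :=
  (hf.isSymmSndFDerivAt (by simp)).eq X Y

theorem conformal_hessian (h : IsLeviCivita M G Γ) {f : E → E} {L : E → ℝ} {n : E → E} {z : E}
    (hz : z ∈ M) (hfz : f z ∈ M) (hf : ContDiffAt ℝ 2 f z) (hL : DifferentiableAt ℝ L z)
    (hconf : ∀ᶠ w in 𝓝 z, ∀ U V,
      G (f w) (fderiv ℝ f w U) (fderiv ℝ f w V) = Real.exp (-2 * L w) * G w U V)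
    (hsurj : Function.Surjective (fderiv ℝ f z)) (hn : ∀ X, G z (n z) X = fderiv ℝ L z X)
    (X Y : E) :
    fderiv ℝ (fderiv ℝ f) z X Y + Γ (f z) (fderiv ℝ f z X) (fderiv ℝ f z Y)
      = fderiv ℝ f z (confConn G Γ L n z X Y) := by
  have hc := hconf.self_of_nhds
  have key : ∀ W U V : E,
      G (f z) (fderiv ℝ (fderiv ℝ f) z W U + Γ (f z) (fderiv ℝ f z W) (fderiv ℝ f z U))
          (fderiv ℝ f z V)
        + G (f z) (fderiv ℝ f z U)
          (fderiv ℝ (fderiv ℝ f) z W V + Γ (f z) (fderiv ℝ f z W) (fderiv ℝ f z V))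
        = Real.exp (-2 * L z) * (-2 * fderiv ℝ L z W * G z U V + G z (Γ z W U) V
          + G z U (Γ z W V)) := by
    intro W U V
    have hfd : HasFDerivAt f (fderiv ℝ f z) z :=
      (hf.differentiableAt (by norm_num)).hasFDerivAt
    have h1 : HasFDerivAt (fun w => G (f w)) ((fderiv ℝ G (f z)).comp (fderiv ℝ f z)) z := by
      have h0 := (h.diff _ hfz).hasFDerivAt
      exact HasFDerivAt.comp (g := G) (g' := fderiv ℝ G (f z)) z h0 hfd
    have h2 := (h1.clm_apply (hasFDerivAt_fderiv_apply hf U)).clm_apply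
      (hasFDerivAt_fderiv_apply hf V)
    have h3 := ((hL.hasFDerivAt.const_mul (-2)).exp).mul
      (((h.diff _ hz).hasFDerivAt.clm_apply (hasFDerivAt_const U z)).clm_apply
        (hasFDerivAt_const V z))
    have h4 : (fun w => G (f w) (fderiv ℝ f w U) (fderiv ℝ f w V))
        =ᶠ[𝓝 z] fun w => Real.exp (-2 * L w) * G w U V := by
      filter_upwards [hconf] with w hw using hw U V
    have h5 := congrArg (fun T : E →L[ℝ] ℝ => T W) (h2.unique (h3.congr_of_eventuallyEq h4))
    simp [h.compat _ hz, h.compat _ hfz] at h5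
    simp only [map_add, add_apply]
    rw [show -(2 * L z) = -2 * L z by ring] at h5
    linear_combination h5
  apply h.eq_of_forall hfz
  intro V
  obtain ⟨Z, rfl⟩ := hsurj V
  rw [hc]
  have k1 := key X Y Z
  have k2 := key Y X Z
  have k3 := key Z X Y
  simp only [confConn, map_add, map_sub, map_smul, add_apply,
    sub_apply, smul_apply, smul_eq_mul, hn] at k1 k2 k3 ⊢
  have s := h.symm _ hz
  have s' := h.symm _ hfz
  have t := h.torsion_free _ hz
  have t' := h.torsion_free _ hfz
  have d := symm_fderiv_fderiv hf
  rw [s' _ (fderiv ℝ (fderiv ℝ f) z X Z), s' _ (Γ (f z) (fderiv ℝ f z X) (fderiv ℝ f z Z)),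
    s _ (Γ z X Z)] at k1
  rw [s' _ (fderiv ℝ (fderiv ℝ f) z Y Z), s' _ (Γ (f z) (fderiv ℝ f z Y) (fderiv ℝ f z Z)),
    s _ (Γ z Y Z), d Y X, t Y X, t' (fderiv ℝ f z Y) (fderiv ℝ f z X)] at k2
  rw [s' _ (fderiv ℝ (fderiv ℝ f) z Z Y), s' _ (Γ (f z) (fderiv ℝ f z Z) (fderiv ℝ f z Y)),
    s _ (Γ z Z Y), d Z X, t Z X, t' (fderiv ℝ f z Z) (fderiv ℝ f z X),
    d Z Y, t Z Y, t' (fderiv ℝ f z Z) (fderiv ℝ f z Y)] at k3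
  linear_combination (k1 + k2 - k3) / 2

theorem connCurv_naturality {f : E → E} {Γ' : E → E → E → E} {z : E} (hf : ContDiffAt ℝ 3 f z)
    (hΓ : DifferentiableAt ℝ Γ (f z)) (hΓ' : ∀ Y Z, DifferentiableAt ℝ (fun w => Γ' w Y Z) z)
    (hnat : ∀ᶠ w in 𝓝 z, ∀ X Y, fderiv ℝ (fderiv ℝ f) w X Y
      + Γ (f w) (fderiv ℝ f w X) (fderiv ℝ f w Y) = fderiv ℝ f w (Γ' w X Y)) (X Y Z : E) :
    connCurv (fun w U V => Γ w U V) (f z) (fderiv ℝ f z X) (fderiv ℝ f z Y) (fderiv ℝ f z Z)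
      = fderiv ℝ f z (connCurv Γ' z X Y Z) := by
  have hf2 : ContDiffAt ℝ 2 f z := hf.of_le (by norm_num)
  have hfd : HasFDerivAt f (fderiv ℝ f z) z :=
    (hf.differentiableAt (by norm_num)).hasFDerivAt
  have hf' : ContDiffAt ℝ 2 (fderiv ℝ f) z := hf.fderiv_right (by norm_num)
  have hf'' : DifferentiableAt ℝ (fderiv ℝ (fderiv ℝ f)) z :=
    (hf'.fderiv_right (m := 1) (by norm_num)).differentiableAt (by norm_num)
  have c0 := hnat.self_of_nhds
  have key : ∀ X Y Z : E,
      fderiv ℝ (fderiv ℝ (fderiv ℝ f)) z X Y Z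
        + fderiv ℝ Γ (f z) (fderiv ℝ f z X) (fderiv ℝ f z Y) (fderiv ℝ f z Z)
        + Γ (f z) (fderiv ℝ (fderiv ℝ f) z X Y) (fderiv ℝ f z Z)
        + Γ (f z) (fderiv ℝ f z Y) (fderiv ℝ (fderiv ℝ f) z X Z)
        = fderiv ℝ (fderiv ℝ f) z X (Γ' z Y Z)
          + fderiv ℝ f z (fderiv ℝ (fun w => Γ' w Y Z) z X) := by
    intro X Y Z
    have h1 : HasFDerivAt (fun w => Γ (f w)) ((fderiv ℝ Γ (f z)).comp (fderiv ℝ f z)) z := by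
      have h0 := hΓ.hasFDerivAt
      exact HasFDerivAt.comp (g := Γ) (g' := fderiv ℝ Γ (f z)) z h0 hfd
    have h2 := (h1.clm_apply (hasFDerivAt_fderiv_apply hf2 Y)).clm_apply
      (hasFDerivAt_fderiv_apply hf2 Z)
    have h3 := ((hf''.hasFDerivAt.clm_apply (hasFDerivAt_const Y z)).clm_apply
        (hasFDerivAt_const Z z)).add h2
    have h4 := (hf'.differentiableAt (by norm_num)).hasFDerivAt.clm_apply (hΓ' Y Z).hasFDerivAt
    have h5 : (fun w => fderiv ℝ f w (Γ' w Y Z)) =ᶠ[𝓝 z] fun w => fderiv ℝ (fderiv ℝ f) w Y Z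
      + Γ (f w) (fderiv ℝ f w Y) (fderiv ℝ f w Z) := by
      filter_upwards [hnat] with w hw using (hw Y Z).symm
    have h6 := congrArg (fun T : E →L[ℝ] E => T X) (h3.unique (h4.congr_of_eventuallyEq h5.symm))
    simp at h6
    rw [add_comm (fderiv ℝ (fderiv ℝ f) z X (Γ' z Y Z)), ← h6]
    abel
  have hΓap : ∀ U V W : E, fderiv ℝ (fun w => Γ w U V) (f z) W = fderiv ℝ Γ (f z) W U V := by
    intro U V W
    have := (hΓ.hasFDerivAt.clm_apply (hasFDerivAt_const U (f z))).clm_apply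
      (hasFDerivAt_const V (f z))
    rw [this.fderiv]; simp
  have D2 : ∀ X Y, fderiv ℝ (fderiv ℝ f) z X Y
      = fderiv ℝ f z (Γ' z X Y) - Γ (f z) (fderiv ℝ f z X) (fderiv ℝ f z Y) := fun X Y =>
    eq_sub_of_add_eq (c0 X Y)
  have k1 := key X Y Z
  have k2 := key Y X Z
  rw [symm_fderiv_fderiv hf' Y X, symm_fderiv_fderiv hf2 Y X] at k2
  have k := congrArg₂ (fun a b => a - b) k1 k2
  simp only [D2 X Z, D2 Y Z, D2 X (Γ' z Y Z), D2 Y (Γ' z X Z), map_sub] at k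
  simp only [connCurv, hΓap, map_sub, map_add]
  rw [← sub_eq_zero] at k ⊢
  rw [← k]
  abel

theorem confConn_curv (h : IsLeviCivita M G Γ) {L : E → ℝ} {n : E → E} {z : E}
    (hz : z ∈ M) (hL : ContDiffAt ℝ 2 L z) (hnd : DifferentiableAt ℝ n z)
    (hn : ∀ᶠ w in 𝓝 z, ∀ X, G w (n w) X = fderiv ℝ L w X) {X Y : E}
    (hX : G z X X = 1) (hY : G z Y Y = 1) (hXY : G z X Y = 0) :
    G z (connCurv (confConn G Γ L n) z X Y Y) X
      = G z (connCurv (fun w U V => Γ w U V) z X Y Y) X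
        + (fderiv ℝ (fderiv ℝ L) z X X - fderiv ℝ L z (Γ z X X) + fderiv ℝ L z X ^ 2
            - G z (n z) (n z) / 2)
        + (fderiv ℝ (fderiv ℝ L) z Y Y - fderiv ℝ L z (Γ z Y Y) + fderiv ℝ L z Y ^ 2
            - G z (n z) (n z) / 2) := by
  have hn0 := hn.self_of_nhds
  have hL' : DifferentiableAt ℝ (fderiv ℝ L) z :=
    (hL.fderiv_right (m := 1) (by norm_num)).differentiableAt (by norm_num)
  have hLY : ∀ Y, HasFDerivAt (fun w => fderiv ℝ L w Y) _ z := fun Y =>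
    hL'.hasFDerivAt.clm_apply (hasFDerivAt_const Y z)
  have hGd : ∀ U V, HasFDerivAt (fun w => G w U V) _ z := fun U V =>
    ((h.diff _ hz).hasFDerivAt.clm_apply (hasFDerivAt_const U z)).clm_apply
      (hasFDerivAt_const V z)
  have hΓd : ∀ U V, HasFDerivAt (fun w => Γ w U V) _ z := fun U V =>
    ((h.diff_conn _ hz).hasFDerivAt.clm_apply (hasFDerivAt_const U z)).clm_apply
      (hasFDerivAt_const V z)
  have hC : ∀ U V W, fderiv ℝ (fun w => confConn G Γ L n w U V) z W
      = fderiv ℝ (fun w => Γ w U V) z W - fderiv ℝ (fderiv ℝ L) z W U • V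
        - fderiv ℝ (fderiv ℝ L) z W V • U + (G z (Γ z W U) V + G z U (Γ z W V)) • n z
        + G z U V • fderiv ℝ n z W := by
    intro U V W
    have := (((hΓd U V).sub ((hLY U).smul (hasFDerivAt_const V z))).sub
      ((hLY V).smul (hasFDerivAt_const U z))).add ((hGd U V).smul hnd.hasFDerivAt)
    have h2 : HasFDerivAt (fun w => confConn G Γ L n w U V) _ z := this
    rw [h2.fderiv, (hΓd U V).fderiv]
    simp [h.compat _ hz]
    abel
  have hN : ∀ W V, G z (fderiv ℝ n z W) V = fderiv ℝ (fderiv ℝ L) z W V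
      - G z (Γ z W (n z)) V - G z (n z) (Γ z W V) := by
    intro W V
    have h1 := ((h.diff _ hz).hasFDerivAt.clm_apply hnd.hasFDerivAt).clm_apply
      (hasFDerivAt_const V z)
    have h2 : (fun w => G w (n w) V) =ᶠ[𝓝 z] fun w => fderiv ℝ L w V := by
      filter_upwards [hn] with w hw using hw V
    have h3 := congrArg (fun T : E →L[ℝ] ℝ => T W) (h1.unique ((hLY V).congr_of_eventuallyEq h2))
    simp [h.compat _ hz] at h3
    linear_combination h3
  have s := h.symm _ hz
  have t := h.torsion_free _ hz
  have hYX : G z Y X = 0 := by rw [s, hXY]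
  have d := symm_fderiv_fderiv hL Y X
  simp only [connCurv, hC]
  simp only [confConn, map_add, map_sub, map_smul, add_apply,
    sub_apply, smul_apply, smul_eq_mul, hN, hX, hY, hXY,
    hYX, ← hn0]
  rw [t Y X, s Y (Γ z X Y), s X (Γ z Y Y), s Y (n z), d, s X (n z)]
  ring
end Abstract

section Algebra

variable {E : Type*} [NormedAddCommGroup E] [NormedSpace ℝ E]

/-- A self-adjoint involution `S` of the Euclidean space `(E, B)`. -/
structure IsReflection (B : E →L[ℝ] E →L[ℝ] ℝ) (S : E →ₗ[ℝ] E) : Prop where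
  symm : ∀ U V, B U V = B V U
  pos : ∀ U, U ≠ 0 → 0 < B U U
  invol : ∀ U, S (S U) = U
  adj : ∀ U V, B (S U) V = B U (S V)

/-- The squared area of the projection of `X ∧ Y` to the `+1`-eigenspace of `S`. -/
def projArea (B : E →L[ℝ] E →L[ℝ] ℝ) (S : E →ₗ[ℝ] E) (X Y : E) : ℝ :=
  (B X X + B (S X) X) / 2 * ((B Y Y + B (S Y) Y) / 2) - ((B X Y + B (S X) Y) / 2) ^ 2

/-- An orthonormal quadruple whose first two members are fixed by `S` and whose last two
members are reversed by `S`. -/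
structure IsAdapted (B : E →L[ℝ] E →L[ℝ] ℝ) (S : E →ₗ[ℝ] E) (X Y Z W : E) : Prop where
  hX : S X = X
  hY : S Y = Y
  hZ : S Z = -Z
  hW : S W = -W
  hXX : B X X = 1
  hYY : B Y Y = 1
  hZZ : B Z Z = 1
  hWW : B W W = 1
  hXY : B X Y = 0
  hZW : B Z W = 0

variable {B : E →L[ℝ] E →L[ℝ] ℝ} {S S' : E →ₗ[ℝ] E}

lemma IsReflection.nonneg (h : IsReflection B S) (U : E) : 0 ≤ B U U := by
  rcases eq_or_ne U 0 with rfl | hU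
  · simp
  · exact (h.pos U hU).le

lemma IsReflection.eq_zero (h : IsReflection B S) {U : E} (hU : B U U ≤ 0) : U = 0 := by
  by_contra hne
  exact absurd (h.pos U hne) (not_lt.2 hU)

lemma IsReflection.exists_normalize (h : IsReflection B S) {U : E} (hU : U ≠ 0) :
    ∃ (r : ℝ) (V : E), U = r • V ∧ V = r⁻¹ • U ∧ B V V = 1 := by
  have hp := h.pos U hU
  have hr0 : √(B U U) ≠ 0 := (Real.sqrt_pos.2 hp).ne'
  have hrr : √(B U U) * √(B U U) = B U U := Real.mul_self_sqrt hp.le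
  refine ⟨√(B U U), (√(B U U))⁻¹ • U, ?_, rfl, ?_⟩
  · rw [smul_smul, mul_inv_cancel₀ hr0, one_smul]
  · simp only [map_smul, smul_apply, smul_eq_mul]
    rw [← mul_assoc, ← mul_inv, hrr, inv_mul_cancel₀ hp.ne']

lemma IsReflection.isom (h : IsReflection B S) (U V : E) : B (S U) (S V) = B U V := by
  rw [h.adj, h.invol]

lemma IsReflection.orthogonal (h : IsReflection B S) {X Z : E} (hX : S X = X) (hZ : S Z = -Z) :
    B X Z = 0 := by
  have := h.adj X Z
  rw [hX, hZ, map_neg] at this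
  linarith

lemma IsReflection.bessel (h : IsReflection B S) {v X Y : E} (hv : B v v = 1) (hX : B X X = 1)
    (hY : B Y Y = 1) (hXY : B X Y = 0) :
    B (v - B v X • X - B v Y • Y) (v - B v X • X - B v Y • Y) = 1 - B v X ^ 2 - B v Y ^ 2 := by
  have hYX : B Y X = 0 := by rw [h.symm, hXY]
  simp only [map_sub, map_smul, sub_apply, smul_apply, smul_eq_mul, hv, hX, hY, hXY, hYX,
    h.symm X v, h.symm Y v]
  ring

lemma IsReflection.minor_bounds (h : IsReflection B S) {X Y : E} (hX : B X X = 1)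
    (hY : B Y Y = 1) (hXY : B X Y = 0) :
    B (S X) X * B (S Y) Y - B (S X) Y ^ 2 ≤ 1 ∧
    -1 ≤ B (S X) X * B (S Y) Y - B (S X) Y ^ 2 ∧
    (B (S X) X * B (S Y) Y - B (S X) Y ^ 2 = 1 →
      ∃ a : ℝ, a ^ 2 = 1 ∧ S X = a • X ∧ S Y = a • Y) := by
  have hYX : B Y X = 0 := by rw [h.symm, hXY]
  have h1 := h.bessel (v := S X) (by rw [h.isom, hX]) hX hY hXY
  have h2 := h.bessel (v := S Y) (by rw [h.isom, hY]) hX hY hXY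
  have hs : B (S Y) X = B (S X) Y := by rw [h.adj, h.symm]
  have n1 := h.nonneg (S X - B (S X) X • X - B (S X) Y • Y)
  have n2 := h.nonneg (S Y - B (S Y) X • X - B (S Y) Y • Y)
  rw [h1] at n1
  rw [h2, hs] at n2
  rw [hs] at h2
  set a := B (S X) X
  set b := B (S X) Y
  set d := B (S Y) Y
  refine ⟨by nlinarith [sq_nonneg (a - d), sq_nonneg b],
    by nlinarith [sq_nonneg (a + d), sq_nonneg b], fun he => ?_⟩
  have hb : b = 0 := by
    have : b ^ 2 ≤ 0 := by nlinarith [sq_nonneg (a - d), sq_nonneg b]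
    exact pow_eq_zero_iff (two_ne_zero) |>.1 (le_antisymm this (sq_nonneg b))
  rw [hb] at he n1 n2 h1 h2
  have had : a = d := by
    have : (a - d) ^ 2 ≤ 0 := by nlinarith
    exact sub_eq_zero.1 (pow_eq_zero_iff (two_ne_zero) |>.1 (le_antisymm this (sq_nonneg _)))
  have ha : a ^ 2 = 1 := by rw [← had] at he; nlinarith
  refine ⟨a, ha, ?_, ?_⟩
  · have := h.eq_zero (U := S X - a • X - (0 : ℝ) • Y) (by rw [h1, ha]; norm_num)
    rw [zero_smul, sub_zero] at this
    exact sub_eq_zero.1 this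
  · have := h.eq_zero (U := S Y - (0 : ℝ) • X - d • Y) (by rw [h2, ← had, ha]; norm_num)
    rw [zero_smul, sub_zero, ← had] at this
    exact sub_eq_zero.1 this

/-- The sum of minors appearing when the curvature-like identity is evaluated on an orthonormal
quadruple. -/
def minorSum (B : E →L[ℝ] E →L[ℝ] ℝ) (S : E →ₗ[ℝ] E) (X Y Z W : E) : ℝ :=
  ((B (S X) X * B (S Y) Y - B (S X) Y ^ 2) + (B (S Z) Z * B (S W) W - B (S Z) W ^ 2)
    - (B (S X) X * B (S Z) Z - B (S X) Z ^ 2) - (B (S Y) Y * B (S W) W - B (S Y) W ^ 2)) / 4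

lemma eq_mul_minorSum (hS : IsReflection B S) {c c' : ℝ} {A : E → ℝ}
    (hcurv : ∀ X Y, B X X = 1 → B Y Y = 1 → B X Y = 0 →
      c' * projArea B S' X Y = c * projArea B S X Y + A X + A Y)
    {X Y Z W : E} (h : IsAdapted B S X Y Z W) : c = c' * minorSum B S' X Y Z W := by
  have hXZ := hS.orthogonal h.hX h.hZ
  have hYW := hS.orthogonal h.hY h.hW
  have e1 := hcurv X Y h.hXX h.hYY h.hXY
  have e2 := hcurv Z W h.hZZ h.hWW h.hZW
  have e3 := hcurv X Z h.hXX h.hZZ hXZ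
  have e4 := hcurv Y W h.hYY h.hWW hYW
  simp only [projArea, h.hX, h.hY, h.hZ, h.hW, h.hXX, h.hYY, h.hZZ, h.hWW, h.hXY, h.hZW, hXZ, hYW,
    map_neg, neg_apply] at e1 e2 e3 e4
  simp only [minorSum]
  linear_combination -e1 - e2 + e3 + e4

lemma abs_minorSum_le (hS : IsReflection B S) (hS' : IsReflection B S') {X Y Z W : E}
    (h : IsAdapted B S X Y Z W) : |minorSum B S' X Y Z W| ≤ 1 ∧
      (minorSum B S' X Y Z W = 1 → ∃ a : ℝ, a ^ 2 = 1 ∧ S' X = a • S X ∧ S' Y = a • S Y ∧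
        S' Z = a • S Z ∧ S' W = a • S W) := by
  have hXZ := hS.orthogonal h.hX h.hZ
  have hYW := hS.orthogonal h.hY h.hW
  obtain ⟨u1, l1, q1⟩ := hS'.minor_bounds h.hXX h.hYY h.hXY
  obtain ⟨u2, l2, q2⟩ := hS'.minor_bounds h.hZZ h.hWW h.hZW
  obtain ⟨u3, l3, -⟩ := hS'.minor_bounds h.hXX h.hZZ hXZ
  obtain ⟨u4, l4, -⟩ := hS'.minor_bounds h.hYY h.hWW hYW
  refine ⟨abs_le.2 ⟨by unfold minorSum; linarith, by unfold minorSum; linarith⟩, fun he => ?_⟩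
  unfold minorSum at he
  obtain ⟨a, ha, hXa, hYa⟩ := q1 (by linarith)
  obtain ⟨b, hb, hZb, hWb⟩ := q2 (by linarith)
  have h3 : B (S' X) X * B (S' Z) Z - B (S' X) Z ^ 2 = -1 := by linarith
  simp only [hXa, hZb, map_smul, smul_apply, smul_eq_mul, h.hXX, h.hZZ, hXZ] at h3
  have hba : b = -a := by
    have : a * b = -1 := by linarith
    calc b = a ^ 2 * b := by rw [ha, one_mul]
      _ = a * (a * b) := by ring
      _ = -a := by rw [this]; ring
  exact ⟨a, ha, by rw [hXa, h.hX], by rw [hYa, h.hY], by rw [hZb, h.hZ, hba]; simp,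
    by rw [hWb, h.hW, hba]; simp⟩

lemma exists_unit_orthogonal (hS : IsReflection B S) {ε : ℝ} {P Q Z : E} (hP : S P = ε • P)
    (hQ : S Q = ε • Q) (hPP : B P P = 1) (hQQ : B Q Q = 1) (hPQ : B P Q = 0) :
    ∃ W, S W = ε • W ∧ B W W = 1 ∧ B Z W = 0 := by
  by_cases hZ : B Z P = 0
  · exact ⟨P, hP, hPP, hZ⟩
  · set V := B Z Q • P - B Z P • Q with hV
    have hQP : B Q P = 0 := by rw [hS.symm, hPQ]
    have hVV : B V V = B Z Q ^ 2 + B Z P ^ 2 := by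
      simp only [hV, map_sub, map_smul, sub_apply, smul_apply, smul_eq_mul, hPP, hQQ, hPQ, hQP]
      ring
    have hpos : 0 < B V V := by rw [hVV]; positivity
    obtain ⟨r, W, -, hW, hWW⟩ := hS.exists_normalize (U := V) (by rintro h0; simp [h0] at hpos)
    refine ⟨W, ?_, hWW, ?_⟩
    · rw [hW, map_smul, smul_comm ε]
      congr 1
      simp only [hV, map_sub, map_smul, hP, hQ, smul_sub, smul_comm ε]
    · simp only [hW, hV, map_sub, map_smul, smul_eq_mul]
      ring

/-- Rigidity of the pure curvature tensor of a product: equality modulo the Kulkarni–Nomizu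
products with the metric forces equality of the curvature constants and of the splittings, up to
exchanging the factors. -/
theorem reflection_rigidity (hS : IsReflection B S) (hS' : IsReflection B S') {c c' : ℝ}
    (hc : c < 0) (hc' : c' < 0) {A : E → ℝ}
    (hcurv : ∀ X Y, B X X = 1 → B Y Y = 1 → B X Y = 0 →
      c' * projArea B S' X Y = c * projArea B S X Y + A X + A Y)
    {X Y Z W X' Y' Z' W' : E} (h : IsAdapted B S X Y Z W) (h' : IsAdapted B S' X' Y' Z' W') :
    c = c' ∧ ∃ a : ℝ, (a = 1 ∨ a = -1) ∧ ∀ U, S' U = a • S U := by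
  have hcc : c = c' := by
    have e1 := eq_mul_minorSum hS hcurv h
    have e2 := eq_mul_minorSum (A := fun X => - A X) hS' (c := c') (c' := c) (S' := S)
      (fun X Y hX hY hXY => by rw [hcurv X Y hX hY hXY]; ring) h'
    have b1 := abs_le.1 (abs_minorSum_le hS hS' h).1
    have b2 := abs_le.1 (abs_minorSum_le hS' hS h').1
    apply le_antisymm
    · nlinarith
    · nlinarith
  refine ⟨hcc, ?_⟩
  have key : ∀ {X Y Z W : E}, IsAdapted B S X Y Z W → ∃ a : ℝ, a ^ 2 = 1 ∧ S' X = a • S X ∧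
      S' Y = a • S Y ∧ S' Z = a • S Z ∧ S' W = a • S W := by
    intro X Y Z W h
    apply (abs_minorSum_le hS hS' h).2
    have e1 := eq_mul_minorSum hS hcurv h
    rw [hcc] at e1
    exact mul_left_cancel₀ hc'.ne (by linarith)
  obtain ⟨a, ha, haX, -, haZ, -⟩ := key h
  have inj : ∀ {b : ℝ} {V : E}, B V V = 1 → a • V = b • V → b = a := by
    intro b V hV hab
    have := congrArg (fun T => B T V) hab
    simpa [hV] using this.symm
  have plus : ∀ U, S U = U → S' U = a • S U := by
    intro U hU
    rcases eq_or_ne U 0 with rfl | hU0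
    · simp
    obtain ⟨r, V, hUV, hV, hVV⟩ := hS.exists_normalize hU0
    have hSV : S V = V := by rw [hV, map_smul, hU]
    obtain ⟨V', h1, h2, h3⟩ := exists_unit_orthogonal (Z := V) (ε := 1) hS (by rw [h.hX, one_smul])
      (by rw [h.hY, one_smul]) h.hXX h.hYY h.hXY
    obtain ⟨b, hb, hbV, -, hbZ, -⟩ := key (X := V) (Y := V') (Z := Z) (W := W)
      ⟨hSV, by rw [h1, one_smul], h.hZ, h.hW, hVV, h2, h.hZZ, h.hWW, h3, h.hZW⟩
    rw [haZ] at hbZ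
    have hba := inj (b := b) h.hZZ (by
      rw [h.hZ, smul_neg, smul_neg] at hbZ; exact neg_injective hbZ)
    rw [hba] at hbV
    rw [hUV, map_smul, map_smul, hbV, smul_comm]
  have minus : ∀ U, S U = -U → S' U = a • S U := by
    intro U hU
    rcases eq_or_ne U 0 with rfl | hU0
    · simp
    obtain ⟨r, V, hUV, hV, hVV⟩ := hS.exists_normalize hU0
    have hSV : S V = -V := by rw [hV, map_smul, hU, smul_neg]
    obtain ⟨V', h1, h2, h3⟩ := exists_unit_orthogonal (Z := V) (ε := -1) hS
      (by rw [h.hZ, neg_one_smul]) (by rw [h.hW, neg_one_smul]) h.hZZ h.hWW h.hZW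
    obtain ⟨b, hb, hbX, -, hbV, -⟩ := key (X := X) (Y := Y) (Z := V) (W := V')
      ⟨h.hX, h.hY, hSV, by rw [h1, neg_one_smul], h.hXX, h.hYY, hVV, h2, h.hXY, h3⟩
    rw [haX] at hbX
    have hba := inj (b := b) h.hXX (by rwa [h.hX] at hbX)
    rw [hba] at hbV
    rw [hUV, map_smul, map_smul, hbV, smul_comm]
  refine ⟨a, sq_eq_one_iff.1 ha, fun U => ?_⟩
  have e1 := plus (U + S U) (by rw [map_add, hS.invol, add_comm])
  have e2 := minus (U - S U) (by rw [map_sub, hS.invol, neg_sub])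
  have : U = (1 / 2 : ℝ) • ((U + S U) + (U - S U)) := by
    rw [add_add_sub_cancel, ← two_smul ℝ U, smul_smul]; norm_num
  rw [this, map_smul, map_add, e1, e2, map_smul, map_add S (U + S U), ← smul_add, smul_comm]

end Algebra

section Grushin

variable {α : ℝ} {F H : Type*} [NormedAddCommGroup F] [InnerProductSpace ℝ F]
  [NormedAddCommGroup H] [InnerProductSpace ℝ H]

lemma hasFDerivAt_norm_rpow_of_ne_zero {x : F} (hx : x ≠ 0) (s : ℝ) :
    HasFDerivAt (fun y : F => ‖y‖ ^ s) ((s * ‖x‖ ^ s / ‖x‖ ^ 2) • innerSL ℝ x) x := by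
  have hn : 0 < ‖x‖ := norm_pos_iff.2 hx
  have h1 := (hasStrictFDerivAt_norm_sq x).hasFDerivAt.rpow_const (p := s / 2)
    (Or.inl (by positivity))
  have h2 : ∀ y : F, ‖y‖ ^ s = (‖y‖ ^ 2) ^ (s / 2) := fun y => by
    rw [← Real.rpow_natCast_mul (norm_nonneg y)]; congr 1; push_cast; ring
  simp only [← h2] at h1
  refine h1.congr_fderiv ?_
  rw [smul_comm, ← smul_assoc, Real.rpow_sub_one (by positivity), ← h2]
  congr 1
  simp; ring

/-- The product `F × H`, with the normed structure as its only structure. -/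
def GProd (F H : Type*) := F × H

namespace GProd

instance : NormedAddCommGroup (GProd F H) := inferInstanceAs (NormedAddCommGroup (F × H))

instance : NormedSpace ℝ (GProd F H) := inferInstanceAs (NormedSpace ℝ (F × H))

instance [FiniteDimensional ℝ F] [FiniteDimensional ℝ H] : FiniteDimensional ℝ (GProd F H) :=
  inferInstanceAs (FiniteDimensional ℝ (F × H))

/-- The point with the given coordinates. -/
def mk (x : F) (y : H) : GProd F H := (x, y)

@[simp] lemma mk_fst (x : F) (y : H) : (mk x y).1 = x := rfl
@[simp] lemma mk_snd (x : F) (y : H) : (mk x y).2 = y := rfl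
@[simp] lemma add_fst (U V : GProd F H) : (U + V).1 = U.1 + V.1 := rfl
@[simp] lemma add_snd (U V : GProd F H) : (U + V).2 = U.2 + V.2 := rfl
@[simp] lemma sub_fst (U V : GProd F H) : (U - V).1 = U.1 - V.1 := rfl
@[simp] lemma sub_snd (U V : GProd F H) : (U - V).2 = U.2 - V.2 := rfl
@[simp] lemma neg_fst (U : GProd F H) : (-U).1 = -U.1 := rfl
@[simp] lemma neg_snd (U : GProd F H) : (-U).2 = -U.2 := rfl
@[simp] lemma smul_fst (c : ℝ) (U : GProd F H) : (c • U).1 = c • U.1 := rfl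
@[simp] lemma smul_snd (c : ℝ) (U : GProd F H) : (c • U).2 = c • U.2 := rfl
@[simp] lemma zero_fst : (0 : GProd F H).1 = 0 := rfl
@[simp] lemma zero_snd : (0 : GProd F H).2 = 0 := rfl

lemma ext {U V : GProd F H} (h₁ : U.1 = V.1) (h₂ : U.2 = V.2) : U = V := Prod.ext h₁ h₂

variable (F H)

/-- The first projection. -/
def fstL : GProd F H →L[ℝ] F := ContinuousLinearMap.fst ℝ F H

/-- The second projection. -/
def sndL : GProd F H →L[ℝ] H := ContinuousLinearMap.snd ℝ F H

/-- The first inclusion. -/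
def inlL : F →L[ℝ] GProd F H := ContinuousLinearMap.inl ℝ F H

/-- The second inclusion. -/
def inrL : H →L[ℝ] GProd F H := ContinuousLinearMap.inr ℝ F H

variable {F H}

@[simp] lemma fstL_apply (U : GProd F H) : fstL F H U = U.1 := rfl
@[simp] lemma sndL_apply (U : GProd F H) : sndL F H U = U.2 := rfl
@[simp] lemma inlL_apply (x : F) : inlL F H x = mk x 0 := rfl
@[simp] lemma inrL_apply (y : H) : inrL F H y = mk 0 y := rfl

end GProd

open GProd

variable (F H) in
/-- The form `⟪U.1, V.1⟫` on a product of inner product spaces. -/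
def innerFst : GProd F H →L[ℝ] GProd F H →L[ℝ] ℝ :=
  ContinuousLinearMap.bilinearComp (innerSL ℝ : F →L[ℝ] F →L[ℝ] ℝ) (fstL F H) (fstL F H)

variable (F H) in
/-- The form `⟪U.2, V.2⟫` on a product of inner product spaces. -/
def innerSnd : GProd F H →L[ℝ] GProd F H →L[ℝ] ℝ :=
  ContinuousLinearMap.bilinearComp (innerSL ℝ : H →L[ℝ] H →L[ℝ] ℝ) (sndL F H) (sndL F H)

@[simp]
lemma innerFst_apply (U V : GProd F H) : innerFst F H U V = ⟪U.1, V.1⟫ := rfl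

@[simp]
lemma innerSnd_apply (U V : GProd F H) : innerSnd F H U V = ⟪U.2, V.2⟫ := rfl

/-- The Grushin metric as a field of continuous bilinear forms. -/
def grushinMetric (α : ℝ) (z : GProd F H) : GProd F H →L[ℝ] GProd F H →L[ℝ] ℝ :=
  ((α + 1) ^ 2 * ‖z.1‖ ^ (2 * α)) • innerFst F H + innerSnd F H

lemma grushinMetric_apply (z U V : GProd F H) :
    grushinMetric α z U V
      = (α + 1) ^ 2 * ‖z.1‖ ^ (2 * α) * ⟪U.1, V.1⟫ + ⟪U.2, V.2⟫ := rfl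

/-- The map `(U, V) ↦ (⟪x, U.1⟫ • V.1, 0)`. -/
def innerSmulFst (H : Type*) [NormedAddCommGroup H] [InnerProductSpace ℝ H] (x : F) :
    GProd F H →L[ℝ] GProd F H →L[ℝ] GProd F H :=
  ContinuousLinearMap.smulRightL ℝ (GProd F H) (GProd F H →L[ℝ] GProd F H)
    ((innerSL ℝ x).comp (fstL F H)) ((inlL F H).comp (fstL F H))

lemma innerSmulFst_apply (x : F) (U V : GProd F H) :
    innerSmulFst H x U V = ⟪x, U.1⟫ • mk V.1 0 := by
  simp [innerSmulFst]

/-- The Levi-Civita connection of the Grushin metric. -/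
def grushinConn (α : ℝ) (z : GProd F H) : GProd F H →L[ℝ] GProd F H →L[ℝ] GProd F H :=
  (α / ‖z.1‖ ^ 2) • (innerSmulFst H z.1 + (innerSmulFst H z.1).flip
    - ((ContinuousLinearMap.smulRightL ℝ (GProd F H) (GProd F H)).flip
        (inlL F H z.1)).comp (innerFst F H))

lemma grushinConn_apply (z U V : GProd F H) :
    grushinConn α z U V
      = mk ((α / ‖z.1‖ ^ 2) • (⟪z.1, V.1⟫ • U.1 + ⟪z.1, U.1⟫ • V.1 - ⟪U.1, V.1⟫ • z.1)) 0 := by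
  apply GProd.ext <;> simp [grushinConn, innerSmulFst_apply, add_comm]

lemma GProd.contDiff_fst : ContDiff ℝ (⊤ : ℕ∞) (fun w : GProd F H => w.1) := (fstL F H).contDiff

lemma hasFDerivAt_norm_fst_rpow {z : GProd F H} (hz : z.1 ≠ 0) (s : ℝ) :
    HasFDerivAt (fun w : GProd F H => ‖w.1‖ ^ s)
      ((s * ‖z.1‖ ^ s / ‖z.1‖ ^ 2) • innerFst F H z) z :=
  (hasFDerivAt_norm_rpow_of_ne_zero (x := z.1) hz s).comp z (fstL F H).hasFDerivAt

lemma hasFDerivAt_grushinMetric {z : GProd F H} (hz : z.1 ≠ 0) :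
    HasFDerivAt (grushinMetric α)
      ((((α + 1) ^ 2) • ((2 * α * ‖z.1‖ ^ (2 * α) / ‖z.1‖ ^ 2)
        • innerFst F H z)).smulRight (innerFst F H)) z := by
  have h := ((hasFDerivAt_norm_fst_rpow hz (2 * α)).const_mul ((α + 1) ^ 2))
  have h1 := ((ContinuousLinearMap.toSpanSingleton ℝ (innerFst F H)).hasFDerivAt.comp z h).add_const
    (innerSnd F H)
  exact h1.congr_fderiv (by ext; simp; ring)

lemma fderiv_grushinMetric {z : GProd F H} (hz : z.1 ≠ 0) (W U V : GProd F H) :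
    fderiv ℝ (grushinMetric α) z W U V
      = (α + 1) ^ 2 * ‖z.1‖ ^ (2 * α) * (2 * α / ‖z.1‖ ^ 2) * ⟪z.1, W.1⟫ * ⟪U.1, V.1⟫ := by
  rw [(hasFDerivAt_grushinMetric hz).fderiv]
  simp only [ContinuousLinearMap.smulRight_apply, smul_apply, innerFst_apply, smul_eq_mul]
  ring

lemma hasFDerivAt_inv_norm_fst_sq {z : GProd F H} (hz : z.1 ≠ 0) (c : ℝ) :
    HasFDerivAt (fun w : GProd F H => c / ‖w.1‖ ^ 2)
      ((-2 * c / (‖z.1‖ ^ 2) ^ 2) • innerFst F H z) z := by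
  have h := (hasFDerivAt_norm_fst_rpow hz (-2)).const_mul c
  have h2 : ∀ x : ℝ, 0 ≤ x → x ^ (-2 : ℝ) = (x ^ 2)⁻¹ := fun x hx => by
    rw [Real.rpow_neg hx]; norm_cast
  simp only [h2 _ (norm_nonneg _), ← div_eq_mul_inv] at h
  refine h.congr_fderiv ?_
  rw [smul_smul]
  congr 1
  rw [pow_two (‖z.1‖ ^ 2), ← div_div]; ring

lemma hasFDerivAt_fst_inner (z V : GProd F H) :
    HasFDerivAt (fun w : GProd F H => ⟪w.1, V.1⟫) (innerFst F H V) z := by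
  have := (innerFst F H V).hasFDerivAt (x := z)
  simp only [real_inner_comm V.1]
  exact this

lemma contDiffAt_grushinConn [FiniteDimensional ℝ F] [FiniteDimensional ℝ H] {z : GProd F H}
    (hz : z.1 ≠ 0) : ContDiffAt ℝ (⊤ : ℕ∞) (grushinConn α : GProd F H → _) z := by
  have ho : IsOpen {w : GProd F H | w.1 ≠ 0} := isOpen_ne.preimage (fstL F H).continuous
  suffices ContDiffOn ℝ (⊤ : ℕ∞) (grushinConn α) {w : GProd F H | w.1 ≠ 0} from
    this.contDiffAt (ho.mem_nhds hz)
  refine contDiffOn_clm_apply.2 fun U => contDiffOn_clm_apply.2 fun V w hw => ?_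
  refine ContDiffAt.contDiffWithinAt ?_
  simp only [grushinConn_apply]
  have hw' : ‖w.1‖ ^ 2 ≠ 0 := pow_ne_zero _ (norm_ne_zero_iff.2 hw)
  have h0 : ContDiffAt ℝ (⊤ : ℕ∞) (fun w : GProd F H => w.1) w :=
    GProd.contDiff_fst.contDiffAt
  have h1 : ∀ V : GProd F H, ContDiffAt ℝ (⊤ : ℕ∞) (fun w : GProd F H => ⟪w.1, V.1⟫) w :=
    fun V => h0.inner ℝ contDiffAt_const
  exact (inlL F H).contDiff.contDiffAt.comp w
    ((contDiffAt_const.div (h0.norm_sq ℝ) hw').smul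
    ((((h1 V).smul contDiffAt_const).add ((h1 U).smul contDiffAt_const)).sub
      (contDiffAt_const.smul h0)))

lemma fderiv_grushinConn {z : GProd F H} (hz : z.1 ≠ 0) (U V W : GProd F H) :
    fderiv ℝ (fun w => grushinConn α w U V) z W
      = mk ((-2 * α * ⟪z.1, W.1⟫ / (‖z.1‖ ^ 2) ^ 2)
          • (⟪z.1, V.1⟫ • U.1 + ⟪z.1, U.1⟫ • V.1 - ⟪U.1, V.1⟫ • z.1)
        + (α / ‖z.1‖ ^ 2) • (⟪W.1, V.1⟫ • U.1 + ⟪W.1, U.1⟫ • V.1 - ⟪U.1, V.1⟫ • W.1)) 0 := by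
  have h2 := (((hasFDerivAt_fst_inner z V).smul_const U.1).add
    ((hasFDerivAt_fst_inner z U).smul_const V.1)).sub
    ((fstL F H).hasFDerivAt.const_smul ⟪U.1, V.1⟫)
  have h3 := (inlL F H).hasFDerivAt.comp z ((hasFDerivAt_inv_norm_fst_sq hz α).smul h2)
  have h4 : (fun w => grushinConn α w U V) = _ := funext fun w => grushinConn_apply w U V
  rw [h4]
  refine (congrArg (fun T : GProd F H →L[ℝ] GProd F H => T W) h3.fderiv).trans ?_
  apply GProd.ext
  · simp [real_inner_comm]
    rw [add_comm]
    congr 2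
    ring
  · simp

lemma grushin_isLeviCivita [FiniteDimensional ℝ F] [FiniteDimensional ℝ H] (hα : 0 < α) :
    IsLeviCivita {z : GProd F H | z.1 ≠ 0} (grushinMetric α) (grushinConn α) where
  symm z hz U V := by
    rw [grushinMetric_apply, grushinMetric_apply, real_inner_comm V.1, real_inner_comm V.2]
  pos z hz U hU := by
    have hz' : 0 < ‖z.1‖ := norm_pos_iff.2 hz
    rw [grushinMetric_apply, real_inner_self_eq_norm_sq, real_inner_self_eq_norm_sq]
    rcases eq_or_ne U.1 0 with h | h
    · have : U.2 ≠ 0 := fun h' => hU (GProd.ext h h')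
      have := norm_pos_iff.2 this
      positivity
    · have := norm_pos_iff.2 h
      positivity
  diff z hz := (hasFDerivAt_grushinMetric hz).differentiableAt
  torsion_free z hz U V := by
    simp only [grushinConn_apply, real_inner_comm U.1 V.1]; congr 2; abel
  diff_conn z hz := (contDiffAt_grushinConn hz).differentiableAt (by simp)
  compat z hz W U V := by
    have hz' : ‖z.1‖ ^ 2 ≠ 0 := pow_ne_zero _ (norm_ne_zero_iff.2 hz)
    rw [fderiv_grushinMetric hz]
    simp only [grushinMetric_apply, grushinConn_apply, mk_fst, mk_snd, inner_sub_left,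
      inner_add_left,
      inner_sub_right, inner_add_right, real_inner_smul_left, real_inner_smul_right,
      inner_zero_left, inner_zero_right]
    rw [real_inner_comm z.1 U.1, real_inner_comm W.1 U.1]
    field_simp
    ring

end Grushin

section GrushinGeometry

open GProd

variable {α : ℝ} {F H : Type*} [NormedAddCommGroup F] [InnerProductSpace ℝ F]
  [NormedAddCommGroup H] [InnerProductSpace ℝ H]

/-- The reflection fixing the vectors tangent to the spheres `|x| = const`, `y = const`. -/
def grushinRefl (H : Type*) [NormedAddCommGroup H] [InnerProductSpace ℝ H] (x : F) :
    GProd F H →ₗ[ℝ] GProd F H where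
  toFun U := mk (U.1 - (2 * ⟪x, U.1⟫ / ‖x‖ ^ 2) • x) (-U.2)
  map_add' U V := by
    apply GProd.ext
    · simp only [mk_fst, add_fst, inner_add_right, mul_add, add_div, add_smul]; abel
    · simp only [mk_snd, add_snd, neg_add]
  map_smul' c U := by
    apply GProd.ext
    · simp only [mk_fst, smul_fst, inner_smul_right, RingHom.id_apply, smul_sub, smul_smul]
      congr 2; ring
    · simp

lemma grushinRefl_apply (x : F) (U : GProd F H) :
    grushinRefl H x U = mk (U.1 - (2 * ⟪x, U.1⟫ / ‖x‖ ^ 2) • x) (-U.2) := rfl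

lemma grushinMetric_refl {z : GProd F H} (U V : GProd F H) :
    grushinMetric α z (grushinRefl H z.1 U) V
      = (α + 1) ^ 2 * ‖z.1‖ ^ (2 * α)
        * (⟪U.1, V.1⟫ - 2 * ⟪z.1, U.1⟫ * ⟪z.1, V.1⟫ / ‖z.1‖ ^ 2) - ⟪U.2, V.2⟫ := by
  simp only [grushinMetric_apply, grushinRefl_apply, mk_fst, mk_snd, inner_sub_left,
    real_inner_smul_left, inner_neg_left]
  ring

lemma grushin_isReflection [FiniteDimensional ℝ F] [FiniteDimensional ℝ H] (hα : 0 < α)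
    {z : GProd F H} (hz : z.1 ≠ 0) : IsReflection (grushinMetric α z) (grushinRefl H z.1) where
  symm := (grushin_isLeviCivita hα).symm z hz
  pos := (grushin_isLeviCivita hα).pos z hz
  invol U := by
    have hz' : ‖z.1‖ ^ 2 ≠ 0 := pow_ne_zero _ (norm_ne_zero_iff.2 hz)
    apply GProd.ext
    · simp only [grushinRefl_apply, mk_fst, inner_sub_right, inner_smul_right,
        real_inner_self_eq_norm_sq, sub_sub, ← add_smul]
      rw [div_mul_cancel₀ _ hz', sub_eq_self,
        show 2 * ⟪z.1, U.1⟫ / ‖z.1‖ ^ 2 + 2 * (⟪z.1, U.1⟫ - 2 * ⟪z.1, U.1⟫) / ‖z.1‖ ^ 2 = 0 by ring,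
        zero_smul]
    · simp [grushinRefl_apply]
  adj U V := by
    rw [(grushin_isLeviCivita hα).symm z hz U, grushinMetric_refl, grushinMetric_refl,
      real_inner_comm U.1 V.1, real_inner_comm U.2 V.2]
    ring

/-- The squared distance `|x| ^ (2 (α + 1))` of `z = (x, y)` to the singular set. -/
def rhoSq (α : ℝ) (z : GProd F H) : ℝ := ‖z.1‖ ^ (2 * α) * ‖z.1‖ ^ 2

lemma rhoSq_pos {z : GProd F H} (hz : z.1 ≠ 0) : 0 < rhoSq α z := by
  have : 0 < ‖z.1‖ := norm_pos_iff.2 hz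
  unfold rhoSq; positivity

lemma grushin_curv (hα : 0 < α) {z : GProd F H} (hz : z.1 ≠ 0) (X Y : GProd F H) :
    grushinMetric α z (connCurv (fun w U V => grushinConn α w U V) z X Y Y) X
      = -(α * (α + 2) / ((α + 1) ^ 2 * rhoSq α z))
        * projArea (grushinMetric α z) (grushinRefl H z.1) X Y := by
  have hz' : ‖z.1‖ ^ 2 ≠ 0 := pow_ne_zero _ (norm_ne_zero_iff.2 hz)
  have hz'' : ‖z.1‖ ^ (2 * α) ≠ 0 :=
    (Real.rpow_pos_of_pos (norm_pos_iff.2 hz) _).ne'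
  have hα1 : α + 1 ≠ 0 := by positivity
  simp only [connCurv, fderiv_grushinConn hz]
  simp only [projArea, grushinMetric_refl]
  simp only [rhoSq, grushinConn_apply, grushinMetric_apply, add_fst, sub_fst, add_snd, sub_snd,
    mk_fst, mk_snd, inner_add_left, inner_add_right, inner_sub_left, inner_sub_right, real_inner_smul_left,
    inner_smul_right, real_inner_self_eq_norm_sq z.1, inner_zero_left]
  rw [real_inner_comm X.1 Y.1, real_inner_comm z.1 X.1, real_inner_comm z.1 Y.1]
  generalize ‖z.1‖ ^ (2 * α) = φ at *
  generalize ‖z.1‖ ^ 2 = N at *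
  field_simp
  ring

/-- The logarithm of the distance `|x| ^ (α + 1)` to the singular set. -/
def logRho (α : ℝ) (z : GProd F H) : ℝ := (α + 1) * Real.log ‖z.1‖

lemma exp_two_mul_logRho {z : GProd F H} (hz : z.1 ≠ 0) :
    Real.exp (2 * logRho α z) = rhoSq α z := by
  have h : 0 < ‖z.1‖ := norm_pos_iff.2 hz
  rw [rhoSq, ← Real.rpow_natCast, ← Real.rpow_add h, Real.rpow_def_of_pos h, logRho]
  congr 1; push_cast; ring

lemma contDiffAt_logRho {z : GProd F H} (hz : z.1 ≠ 0) :
    ContDiffAt ℝ (⊤ : ℕ∞) (logRho α) z :=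
  contDiffAt_const.mul ((GProd.contDiff_fst.contDiffAt.norm ℝ hz).log (norm_ne_zero_iff.2 hz))

lemma hasFDerivAt_logRho {z : GProd F H} (hz : z.1 ≠ 0) :
    HasFDerivAt (logRho α) (((α + 1) / ‖z.1‖ ^ 2) • innerFst F H z) z := by
  have h : 0 < ‖z.1‖ := norm_pos_iff.2 hz
  have h1 := ((hasFDerivAt_norm_fst_rpow hz 1).log (by positivity)).const_mul (α + 1)
  simp only [Real.rpow_one] at h1
  refine h1.congr_fderiv ?_
  rw [smul_smul, smul_smul]
  congr 1
  field_simp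

lemma fderiv_logRho {z : GProd F H} (hz : z.1 ≠ 0) (X : GProd F H) :
    fderiv ℝ (logRho α) z X = (α + 1) / ‖z.1‖ ^ 2 * ⟪z.1, X.1⟫ := by
  rw [(hasFDerivAt_logRho hz).fderiv]; rfl

lemma fderiv_fderiv_logRho {z : GProd F H} (hz : z.1 ≠ 0) (X Y : GProd F H) :
    fderiv ℝ (fderiv ℝ (logRho α)) z X Y
      = (α + 1) / ‖z.1‖ ^ 2 * ⟪X.1, Y.1⟫
        - 2 * (α + 1) / (‖z.1‖ ^ 2) ^ 2 * ⟪z.1, X.1⟫ * ⟪z.1, Y.1⟫ := by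
  have ho : IsOpen {w : GProd F H | w.1 ≠ 0} := isOpen_ne.preimage (fstL F H).continuous
  have h0 : (fun w => fderiv ℝ (logRho α) w Y) =ᶠ[𝓝 z]
      fun w : GProd F H => (α + 1) / ‖w.1‖ ^ 2 * ⟪w.1, Y.1⟫ := by
    filter_upwards [ho.mem_nhds hz] with w hw using fderiv_logRho hw Y
  have h1 := (hasFDerivAt_inv_norm_fst_sq hz (α + 1)).mul (hasFDerivAt_fst_inner z Y)
  have h2 : DifferentiableAt ℝ (fderiv ℝ (logRho α)) z :=
    ((contDiffAt_logRho hz).fderiv_right (m := 1) (by norm_cast)).differentiableAt (by simp)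
  have h3 := (h2.hasFDerivAt.clm_apply (hasFDerivAt_const Y z)).fderiv
  have h4 := congrArg (fun T : GProd F H →L[ℝ] ℝ => T X)
    (h3.symm.trans (h0.fderiv_eq.trans h1.fderiv))
  simp at h4
  rw [h4, real_inner_comm Y.1 X.1]
  ring

lemma hess_logRho {z : GProd F H} (hz : z.1 ≠ 0) (X Y : GProd F H) :
    fderiv ℝ (fderiv ℝ (logRho α)) z X Y - fderiv ℝ (logRho α) z (grushinConn α z X Y)
      = (grushinMetric α z X Y + grushinMetric α z (grushinRefl H z.1 X) Y) / 2 / rhoSq α z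
        - fderiv ℝ (logRho α) z X * fderiv ℝ (logRho α) z Y := by
  have hz' : ‖z.1‖ ^ 2 ≠ 0 := pow_ne_zero _ (norm_ne_zero_iff.2 hz)
  have hz'' : ‖z.1‖ ^ (2 * α) ≠ 0 :=
    (Real.rpow_pos_of_pos (norm_pos_iff.2 hz) _).ne'
  rw [fderiv_fderiv_logRho hz, grushinMetric_refl]
  simp only [fderiv_logRho hz, grushinConn_apply, grushinMetric_apply, rhoSq, mk_fst,
    inner_smul_right, inner_add_right, inner_sub_right, real_inner_self_eq_norm_sq z.1]
  generalize ‖z.1‖ ^ (2 * α) = φ at *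
  generalize ‖z.1‖ ^ 2 = N at *
  field_simp
  ring

/-- The gradient of `logRho`. -/
def gradLogRho (α : ℝ) (z : GProd F H) : GProd F H := mk (((α + 1) * rhoSq α z)⁻¹ • z.1) 0

lemma grushinMetric_gradLogRho (hα : 0 < α) {z : GProd F H} (hz : z.1 ≠ 0) (X : GProd F H) :
    grushinMetric α z (gradLogRho α z) X = fderiv ℝ (logRho α) z X := by
  have hz' : ‖z.1‖ ^ 2 ≠ 0 := pow_ne_zero _ (norm_ne_zero_iff.2 hz)
  have hz'' : ‖z.1‖ ^ (2 * α) ≠ 0 :=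
    (Real.rpow_pos_of_pos (norm_pos_iff.2 hz) _).ne'
  have hα1 : α + 1 ≠ 0 := by positivity
  simp only [fderiv_logRho hz, gradLogRho, grushinMetric_apply, rhoSq, mk_fst, mk_snd,
    real_inner_smul_left, inner_zero_left]
  field_simp
  ring

lemma grushinMetric_gradLogRho_self (hα : 0 < α) {z : GProd F H} (hz : z.1 ≠ 0) :
    grushinMetric α z (gradLogRho α z) (gradLogRho α z) = (rhoSq α z)⁻¹ := by
  have hz' : ‖z.1‖ ^ 2 ≠ 0 := pow_ne_zero _ (norm_ne_zero_iff.2 hz)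
  have hz'' : rhoSq α z ≠ 0 := (rhoSq_pos hz).ne'
  have hα1 : α + 1 ≠ 0 := by positivity
  rw [grushinMetric_gradLogRho hα hz, fderiv_logRho hz]
  simp only [gradLogRho, mk_fst, inner_smul_right, real_inner_self_eq_norm_sq z.1]
  field_simp

/-- The gradient of a function for the Grushin metric. -/
def grushinGrad [CompleteSpace F] [CompleteSpace H] (α : ℝ) (L : GProd F H → ℝ) (z : GProd F H) :
    GProd F H :=
  mk (((α + 1) ^ 2 * ‖z.1‖ ^ (2 * α))⁻¹ •
      (InnerProductSpace.toDual ℝ F).symm ((fderiv ℝ L z).comp (inlL F H)))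
    ((InnerProductSpace.toDual ℝ H).symm ((fderiv ℝ L z).comp (inrL F H)))

lemma grushinMetric_grad [CompleteSpace F] [CompleteSpace H] (hα : 0 < α) {z : GProd F H}
    (hz : z.1 ≠ 0) (L : GProd F H → ℝ) (X : GProd F H) :
    grushinMetric α z (grushinGrad α L z) X = fderiv ℝ L z X := by
  have hz'' : ‖z.1‖ ^ (2 * α) ≠ 0 :=
    (Real.rpow_pos_of_pos (norm_pos_iff.2 hz) _).ne'
  have hα1 : α + 1 ≠ 0 := by positivity
  have hX : X = mk X.1 0 + mk 0 X.2 := by apply GProd.ext <;> simp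
  rw [grushinMetric_apply]
  simp only [grushinGrad, mk_fst, mk_snd, real_inner_smul_left]
  rw [mul_inv_cancel_left₀ (by positivity), InnerProductSpace.toDual_symm_apply,
    InnerProductSpace.toDual_symm_apply]
  conv_rhs => rw [hX, map_add]
  rfl

lemma differentiableAt_grushinGrad [CompleteSpace F] [CompleteSpace H] (hα : 0 < α)
    {z : GProd F H} (hz : z.1 ≠ 0) {L : GProd F H → ℝ} (hL : ContDiffAt ℝ 2 L z) :
    DifferentiableAt ℝ (grushinGrad α L) z := by
  have hz'' : 0 < ‖z.1‖ ^ (2 * α) := Real.rpow_pos_of_pos (norm_pos_iff.2 hz) _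
  have h1 : DifferentiableAt ℝ (fderiv ℝ L) z :=
    (hL.fderiv_right (m := 1) (by norm_num)).differentiableAt (by simp)
  have h2 : DifferentiableAt ℝ (fun w : GProd F H => ((α + 1) ^ 2 * ‖w.1‖ ^ (2 * α))⁻¹) z :=
    ((hasFDerivAt_norm_fst_rpow hz _).differentiableAt.const_mul _).inv (by positivity)
  have h3 := ((InnerProductSpace.toDual ℝ F).symm.toContinuousLinearEquiv.differentiableAt).comp z
    (h1.clm_comp (differentiableAt_const (inlL F H)))
  have h4 := ((InnerProductSpace.toDual ℝ H).symm.toContinuousLinearEquiv.differentiableAt).comp z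
    (h1.clm_comp (differentiableAt_const (inrL F H)))
  have h5 := ((inlL F H).differentiableAt.comp z (h2.smul h3)).add
    ((inrL F H).differentiableAt.comp z h4)
  refine h5.congr_of_eventuallyEq (Filter.Eventually.of_forall fun w => ?_)
  apply GProd.ext <;> simp [grushinGrad]

end GrushinGeometry

section GrushinConformal

open GProd

variable {α : ℝ} {F H : Type*} [NormedAddCommGroup F] [InnerProductSpace ℝ F]
  [NormedAddCommGroup H] [InnerProductSpace ℝ H]

/-- The map `f` is conformal on `Ω` for the Grushin metric, with conformal factor `exp L`. -/
structure GrushinConformal (α : ℝ) (Ω : Set (GProd F H)) (f : GProd F H → GProd F H)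
    (L : GProd F H → ℝ) : Prop where
  pos : 0 < α
  isOpen : IsOpen Ω
  ne_zero : ∀ z ∈ Ω, z.1 ≠ 0
  map_ne_zero : ∀ z ∈ Ω, (f z).1 ≠ 0
  smooth : ∀ z ∈ Ω, ContDiffAt ℝ 3 f z
  smooth_log : ∀ z ∈ Ω, ContDiffAt ℝ 2 L z
  conf : ∀ z ∈ Ω, ∀ U V, grushinMetric α (f z) (fderiv ℝ f z U) (fderiv ℝ f z V)
    = Real.exp (-2 * L z) * grushinMetric α z U V

/-- The constant of curvature of the planes tangent to the spheres. -/
def grushinK (α : ℝ) (z : GProd F H) : ℝ := -(α * (α + 2) / ((α + 1) ^ 2 * rhoSq α z))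

/-- The derivative of `f`, as a linear equivalence. -/
def IsDerivEquiv (f : GProd F H → GProd F H) (z : GProd F H) (D : GProd F H ≃ₗ[ℝ] GProd F H) :
    Prop := ∀ U, D U = fderiv ℝ f z U

/-- The reflection of the target, pulled back by the derivative of `f`. -/
def pullRefl (x : F) (D : GProd F H ≃ₗ[ℝ] GProd F H) : GProd F H →ₗ[ℝ] GProd F H :=
  D.symm.toLinearMap ∘ₗ grushinRefl H x ∘ₗ D.toLinearMap

lemma map_pullRefl (x : F) (D : GProd F H ≃ₗ[ℝ] GProd F H) (U : GProd F H) :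
    D (pullRefl x D U) = grushinRefl H x (D U) := by simp [pullRefl]

namespace GrushinConformal

variable [FiniteDimensional ℝ F] [FiniteDimensional ℝ H]
  {Ω : Set (GProd F H)} {f : GProd F H → GProd F H} {L : GProd F H → ℝ} {z : GProd F H}
  {D : GProd F H ≃ₗ[ℝ] GProd F H}

lemma exists_derivEquiv (h : GrushinConformal α Ω f L) (hz : z ∈ Ω) :
    ∃ D : GProd F H ≃ₗ[ℝ] GProd F H, IsDerivEquiv f z D := by
  have hi : Function.Injective (fderiv ℝ f z : GProd F H →ₗ[ℝ] GProd F H) := by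
    rw [injective_iff_map_eq_zero]
    intro U hU
    by_contra hne
    have h1 := h.conf z hz U U
    have h2 := (grushin_isLeviCivita h.pos).pos z (h.ne_zero z hz) U hne
    rw [ContinuousLinearMap.coe_coe] at hU
    rw [hU, map_zero] at h1
    exact (mul_pos (Real.exp_pos (-2 * L z)) h2).ne h1
  exact ⟨LinearEquiv.ofInjectiveEndo _ hi, fun U => by simp⟩

lemma conf_equiv (h : GrushinConformal α Ω f L) (hz : z ∈ Ω) (hD : IsDerivEquiv f z D)
    (U V : GProd F H) : grushinMetric α (f z) (D U) (D V)
      = Real.exp (-2 * L z) * grushinMetric α z U V := by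
  rw [hD, hD, h.conf z hz]

lemma isReflection_pullRefl (h : GrushinConformal α Ω f L) (hz : z ∈ Ω) (hD : IsDerivEquiv f z D) :
    IsReflection (grushinMetric α z) (pullRefl (f z).1 D) where
  symm := (grushin_isLeviCivita h.pos).symm z (h.ne_zero z hz)
  pos := (grushin_isLeviCivita h.pos).pos z (h.ne_zero z hz)
  invol U := by
    apply D.injective
    rw [map_pullRefl, map_pullRefl,
      (grushin_isReflection h.pos (h.map_ne_zero z hz)).invol]
  adj U V := by
    have h1 := (grushin_isReflection h.pos (h.map_ne_zero z hz)).adj (D U) (D V)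
    rw [← map_pullRefl, ← map_pullRefl, h.conf_equiv hz hD, h.conf_equiv hz hD] at h1
    exact mul_left_cancel₀ (Real.exp_pos _).ne' h1

lemma surjective_fderiv (h : GrushinConformal α Ω f L) (hz : z ∈ Ω) :
    Function.Surjective (fderiv ℝ f z) := by
  obtain ⟨D, hD⟩ := h.exists_derivEquiv hz
  intro U
  obtain ⟨V, rfl⟩ := D.surjective U
  exact ⟨V, (hD V).symm⟩

lemma hessian (h : GrushinConformal α Ω f L) (hz : z ∈ Ω) (X Y : GProd F H) :
    fderiv ℝ (fderiv ℝ f) z X Y + grushinConn α (f z) (fderiv ℝ f z X) (fderiv ℝ f z Y)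
      = fderiv ℝ f z (confConn (grushinMetric α) (grushinConn α) L (grushinGrad α L) z X Y) := by
  have := FiniteDimensional.complete ℝ F
  have := FiniteDimensional.complete ℝ H
  exact conformal_hessian (grushin_isLeviCivita h.pos) (h.ne_zero z hz) (h.map_ne_zero z hz)
    ((h.smooth z hz).of_le (by norm_num)) ((h.smooth_log z hz).differentiableAt (by simp))
    (Filter.eventually_of_mem (h.isOpen.mem_nhds hz) h.conf) (h.surjective_fderiv hz)
    (grushinMetric_grad h.pos (h.ne_zero z hz) L) X Y

/-- The modified Hessian of `L` measuring the change of the sectional curvatures. -/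
def schouten (α : ℝ) (L : GProd F H → ℝ) (z X : GProd F H) : ℝ :=
  fderiv ℝ (fderiv ℝ L) z X X - fderiv ℝ L z (grushinConn α z X X) + fderiv ℝ L z X ^ 2
    - grushinMetric α z (grushinGrad α L z) (grushinGrad α L z) / 2

lemma differentiableAt_confConn (h : GrushinConformal α Ω f L) (hz : z ∈ Ω) (Y Z : GProd F H) :
    DifferentiableAt ℝ (fun w => confConn (grushinMetric α) (grushinConn α) L (grushinGrad α L) w
      Y Z) z := by
  have := FiniteDimensional.complete ℝ F
  have := FiniteDimensional.complete ℝ H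
  have hz' := h.ne_zero z hz
  have hL := h.smooth_log z hz
  have h1 : DifferentiableAt ℝ (fderiv ℝ L) z :=
    (hL.fderiv_right (m := 1) (by norm_num)).differentiableAt (by simp)
  have h2 (W : GProd F H) : DifferentiableAt ℝ (fun w => fderiv ℝ L w W) z :=
    h1.clm_apply (differentiableAt_const _)
  have h3 : DifferentiableAt ℝ (fun w => grushinConn α w Y Z) z :=
    (((grushin_isLeviCivita h.pos).diff_conn z hz').clm_apply
      (differentiableAt_const _)).clm_apply (differentiableAt_const _)
  have h4 : DifferentiableAt ℝ (fun w => grushinMetric α w Y Z) z :=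
    (((grushin_isLeviCivita h.pos).diff z hz').clm_apply
      (differentiableAt_const _)).clm_apply (differentiableAt_const _)
  exact ((h3.sub ((h2 Y).smul_const _)).sub ((h2 Z).smul_const _)).add
    (h4.smul (differentiableAt_grushinGrad h.pos hz' hL))

lemma curv (h : GrushinConformal α Ω f L) (hz : z ∈ Ω) (hD : IsDerivEquiv f z D)
    {X Y : GProd F H} (hX : grushinMetric α z X X = 1) (hY : grushinMetric α z Y Y = 1)
    (hXY : grushinMetric α z X Y = 0) :
    Real.exp (-2 * L z) * grushinK α (f z) * projArea (grushinMetric α z) (pullRefl (f z).1 D) X Y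
      = grushinK α z * projArea (grushinMetric α z) (grushinRefl H z.1) X Y
        + schouten α L z X + schouten α L z Y := by
  have := FiniteDimensional.complete ℝ F
  have := FiniteDimensional.complete ℝ H
  have hz' := h.ne_zero z hz
  have h1 := confConn_curv (grushin_isLeviCivita h.pos) hz' (h.smooth_log z hz)
    (differentiableAt_grushinGrad h.pos hz' (h.smooth_log z hz))
    (Filter.eventually_of_mem (h.isOpen.mem_nhds hz) fun w hw =>
      grushinMetric_grad h.pos (h.ne_zero w hw) L) hX hY hXY
  have h2 := connCurv_naturality (Γ := grushinConn α)
    (Γ' := confConn (grushinMetric α) (grushinConn α) L (grushinGrad α L)) (h.smooth z hz)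
    ((grushin_isLeviCivita h.pos).diff_conn _ (h.map_ne_zero z hz)) (h.differentiableAt_confConn hz)
    (Filter.eventually_of_mem (h.isOpen.mem_nhds hz) fun w hw => h.hessian hw) X Y Y
  have h3 := grushin_curv h.pos (h.map_ne_zero z hz) (fderiv ℝ f z X) (fderiv ℝ f z Y)
  rw [h2, h.conf z hz, h1, grushin_curv h.pos hz'] at h3
  have h4 : projArea (grushinMetric α (f z)) (grushinRefl H (f z).1) (fderiv ℝ f z X)
      (fderiv ℝ f z Y) = Real.exp (-2 * L z) ^ 2 *
        projArea (grushinMetric α z) (pullRefl (f z).1 D) X Y := by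
    simp only [projArea, ← hD X, ← hD Y, ← map_pullRefl, h.conf_equiv hz hD]
    ring
  rw [h4] at h3
  have h5 := Real.exp_pos (-2 * L z)
  refine mul_left_cancel₀ h5.ne' ?_
  simp only [grushinK, schouten]
  linear_combination -h3

end GrushinConformal

end GrushinConformal

section GrushinRigidity

open GProd

variable {α : ℝ} {F H : Type*} [NormedAddCommGroup F] [InnerProductSpace ℝ F]
  [NormedAddCommGroup H] [InnerProductSpace ℝ H]
  [FiniteDimensional ℝ F] [FiniteDimensional ℝ H]

lemma exists_orthonormal_orthogonal (hF : 3 ≤ Module.finrank ℝ F) (x : F) :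
    ∃ v w : F, ⟪x, v⟫ = 0 ∧ ⟪x, w⟫ = 0 ∧ ⟪v, v⟫ = 1 ∧ ⟪w, w⟫ = 1 ∧ ⟪v, w⟫ = 0 := by
  have h1 := Submodule.finrank_add_finrank_orthogonal (Submodule.span ℝ {x})
  have h2 : Module.finrank ℝ (Submodule.span ℝ {x}) ≤ 1 :=
    (finrank_span_le_card ({x} : Set F)).trans (by simp)
  have h3 : 2 ≤ Module.finrank ℝ (Submodule.span ℝ {x})ᗮ := by omega
  set b := stdOrthonormalBasis ℝ (Submodule.span ℝ {x})ᗮ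
  have hb := orthonormal_iff_ite.1 b.orthonormal
  refine ⟨b ⟨0, by omega⟩, b ⟨1, by omega⟩,
    Submodule.mem_orthogonal_singleton_iff_inner_right.1 (b _).2,
    Submodule.mem_orthogonal_singleton_iff_inner_right.1 (b _).2, ?_, ?_, ?_⟩
  · exact (hb _ _).trans (by simp)
  · exact (hb _ _).trans (by simp)
  · exact (hb _ _).trans (by simp)

lemma exists_isAdapted [Nontrivial H] (hα : 0 < α) (hF : 3 ≤ Module.finrank ℝ F)
    {z : GProd F H} (hz : z.1 ≠ 0) :
    ∃ X Y Z W, IsAdapted (grushinMetric α z) (grushinRefl H z.1) X Y Z W := by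
  obtain ⟨v, w, hv, hw, hvv, hww, hvw⟩ := exists_orthonormal_orthogonal hF z.1
  obtain ⟨e, he⟩ := exists_norm_eq H zero_le_one
  have hz0 : 0 < ‖z.1‖ := norm_pos_iff.2 hz
  have hφ : 0 < (α + 1) ^ 2 * ‖z.1‖ ^ (2 * α) := by positivity
  obtain ⟨s, hs⟩ : ∃ s : ℝ, (α + 1) ^ 2 * ‖z.1‖ ^ (2 * α) * (s * s) = 1 := by
    refine ⟨(√((α + 1) ^ 2 * ‖z.1‖ ^ (2 * α)))⁻¹, ?_⟩
    rw [← mul_inv, Real.mul_self_sqrt hφ.le, mul_inv_cancel₀ hφ.ne']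
  have hx : ‖z.1‖ ^ 2 ≠ 0 := by positivity
  refine ⟨mk (s • v) 0, mk (s • w) 0, mk ((s * ‖z.1‖⁻¹) • z.1) 0, mk 0 e, ?_, ?_, ?_, ?_, ?_, ?_,
    ?_, ?_, ?_, ?_⟩
  · simp [grushinRefl_apply, inner_smul_right, hv]
  · simp [grushinRefl_apply, inner_smul_right, hw]
  · apply GProd.ext
    · simp only [grushinRefl_apply, mk_fst, neg_fst, inner_smul_right, real_inner_self_eq_norm_sq,
        ← sub_smul, ← neg_smul]
      congr 1; field_simp; ring
    · simp [grushinRefl_apply]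
  · apply GProd.ext <;> simp [grushinRefl_apply]
  · simp only [grushinMetric_apply, mk_fst, mk_snd, inner_smul_right, real_inner_smul_left, hvv,
      inner_zero_left]
    linear_combination hs
  · simp only [grushinMetric_apply, mk_fst, mk_snd, inner_smul_right, real_inner_smul_left, hww,
      inner_zero_left]
    linear_combination hs
  · simp only [grushinMetric_apply, mk_fst, mk_snd, inner_smul_right, real_inner_smul_left,
      inner_zero_left, real_inner_self_eq_norm_sq]
    generalize ‖z.1‖ ^ (2 * α) = φ at *
    field_simp
    linear_combination hs
  · simp [grushinMetric_apply, he]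
  · simp [grushinMetric_apply, inner_smul_right, real_inner_smul_left, hvw]
  · simp [grushinMetric_apply]

lemma grushinK_neg (hα : 0 < α) {z : GProd F H} (hz : z.1 ≠ 0) : grushinK α z < 0 := by
  have := rhoSq_pos (α := α) hz
  unfold grushinK
  rw [neg_lt_zero]
  positivity

lemma fderiv_logRho_refl {z : GProd F H} (hz : z.1 ≠ 0) (U : GProd F H) :
    fderiv ℝ (logRho α) z (grushinRefl H z.1 U) = -fderiv ℝ (logRho α) z U := by
  have hx : ‖z.1‖ ^ 2 ≠ 0 := pow_ne_zero _ (norm_ne_zero_iff.2 hz)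
  simp only [fderiv_logRho hz, grushinRefl_apply, mk_fst, inner_sub_right, inner_smul_right,
    real_inner_self_eq_norm_sq]
  field_simp
  ring

namespace GrushinConformal

variable {Ω : Set (GProd F H)} {f : GProd F H → GProd F H} {L : GProd F H → ℝ} {z : GProd F H}
  {D : GProd F H ≃ₗ[ℝ] GProd F H}

lemma isAdapted_pullRefl (h : GrushinConformal α Ω f L) (hz : z ∈ Ω) (hD : IsDerivEquiv f z D)
    {X Y Z W : GProd F H} (ha : IsAdapted (grushinMetric α (f z)) (grushinRefl H (f z).1) X Y Z W) :
    IsAdapted (grushinMetric α z) (pullRefl (f z).1 D) (Real.exp (-L z) • D.symm X)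
      (Real.exp (-L z) • D.symm Y) (Real.exp (-L z) • D.symm Z) (Real.exp (-L z) • D.symm W) := by
  have hG (U V : GProd F H) : grushinMetric α z (Real.exp (-L z) • D.symm U)
      (Real.exp (-L z) • D.symm V) = grushinMetric α (f z) U V := by
    have h1 := h.conf_equiv hz hD (D.symm U) (D.symm V)
    rw [D.apply_symm_apply, D.apply_symm_apply] at h1
    rw [h1, show -2 * L z = -L z + -L z by ring, Real.exp_add]
    simp only [map_smul, smul_apply, smul_eq_mul]
    ring
  have hS (U : GProd F H) : pullRefl (f z).1 D (Real.exp (-L z) • D.symm U)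
      = Real.exp (-L z) • D.symm (grushinRefl H (f z).1 U) := by
    simp [pullRefl]
  constructor
  · rw [hS, ha.hX]
  · rw [hS, ha.hY]
  · rw [hS, ha.hZ, map_neg, smul_neg]
  · rw [hS, ha.hW, map_neg, smul_neg]
  · rw [hG, ha.hXX]
  · rw [hG, ha.hYY]
  · rw [hG, ha.hZZ]
  · rw [hG, ha.hWW]
  · rw [hG, ha.hXY]
  · rw [hG, ha.hZW]

lemma rigidity [Nontrivial H] (hF : 3 ≤ Module.finrank ℝ F) (h : GrushinConformal α Ω f L)
    (hz : z ∈ Ω) (hD : IsDerivEquiv f z D) :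
    grushinK α z = Real.exp (-2 * L z) * grushinK α (f z) ∧
      ∃ a : ℝ, (a = 1 ∨ a = -1) ∧ ∀ U, pullRefl (f z).1 D U = a • grushinRefl H z.1 U := by
  obtain ⟨X, Y, Z, W, h1⟩ := exists_isAdapted h.pos hF (h.ne_zero z hz)
  obtain ⟨X', Y', Z', W', h2⟩ := exists_isAdapted h.pos hF (h.map_ne_zero z hz)
  exact reflection_rigidity (A := schouten α L z) (grushin_isReflection h.pos (h.ne_zero z hz))
    (h.isReflection_pullRefl hz hD) (grushinK_neg h.pos (h.ne_zero z hz))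
    (mul_neg_of_pos_of_neg (Real.exp_pos _) (grushinK_neg h.pos (h.map_ne_zero z hz)))
    (fun X Y hX hY hXY => h.curv hz hD hX hY hXY) h1 (h.isAdapted_pullRefl hz hD h2)

variable [Nontrivial H] (hF : 3 ≤ Module.finrank ℝ F)
include hF

lemma rhoSq_eq (h : GrushinConformal α Ω f L) (hz : z ∈ Ω) :
    rhoSq α (f z) = Real.exp (-2 * L z) * rhoSq α z := by
  obtain ⟨D, hD⟩ := h.exists_derivEquiv hz
  have h1 := (h.rigidity hF hz hD).1
  have hα := h.pos
  have h2 := rhoSq_pos (α := α) (h.ne_zero z hz)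
  have h3 := rhoSq_pos (α := α) (h.map_ne_zero z hz)
  unfold grushinK at h1
  generalize Real.exp (-2 * L z) = E at *
  field_simp at h1
  linarith

lemma log_eq (h : GrushinConformal α Ω f L) (hz : z ∈ Ω) :
    L z = logRho α z - logRho α (f z) := by
  have h1 := h.rhoSq_eq hF hz
  rw [← exp_two_mul_logRho (h.ne_zero z hz), ← exp_two_mul_logRho (h.map_ne_zero z hz),
    ← Real.exp_add] at h1
  have h2 := Real.exp_injective h1
  linarith

lemma fderiv_log (h : GrushinConformal α Ω f L) (hz : z ∈ Ω) (X : GProd F H) :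
    fderiv ℝ L z X
      = fderiv ℝ (logRho α) z X - fderiv ℝ (logRho α) (f z) (fderiv ℝ f z X) := by
  have h1 : L =ᶠ[𝓝 z] fun w => logRho α w - logRho α (f w) :=
    Filter.eventually_of_mem (h.isOpen.mem_nhds hz) fun w hw => h.log_eq hF hw
  have h2 := ((contDiffAt_logRho (α := α) (h.map_ne_zero z hz)).differentiableAt
    (by simp)).hasFDerivAt.comp z ((h.smooth z hz).differentiableAt (by simp)).hasFDerivAt
  have h3 := ((contDiffAt_logRho (α := α) (h.ne_zero z hz)).differentiableAt
    (by simp)).hasFDerivAt.sub h2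
  exact congrArg (fun T : GProd F H →L[ℝ] ℝ => T X) (h1.fderiv_eq.trans h3.fderiv)

lemma fderiv_fderiv_log (h : GrushinConformal α Ω f L) (hz : z ∈ Ω) (X Y : GProd F H) :
    fderiv ℝ (fderiv ℝ L) z X Y
      = fderiv ℝ (fderiv ℝ (logRho α)) z X Y
        - fderiv ℝ (fderiv ℝ (logRho α)) (f z) (fderiv ℝ f z X) (fderiv ℝ f z Y)
        - fderiv ℝ (logRho α) (f z) (fderiv ℝ (fderiv ℝ f) z X Y) := by
  have h1 : (fun w => fderiv ℝ L w Y) =ᶠ[𝓝 z] fun w => fderiv ℝ (logRho α) w Y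
      - fderiv ℝ (logRho α) (f w) (fderiv ℝ f w Y) :=
    Filter.eventually_of_mem (h.isOpen.mem_nhds hz) fun w hw => h.fderiv_log hF hw Y
  have hd {w : GProd F H} (hw : w.1 ≠ 0) : DifferentiableAt ℝ (fderiv ℝ (logRho α)) w :=
    ((contDiffAt_logRho hw).fderiv_right (m := 1) (by norm_cast)).differentiableAt (by simp)
  have hL : DifferentiableAt ℝ (fderiv ℝ L) z :=
    ((h.smooth_log z hz).fderiv_right (m := 1) (by norm_num)).differentiableAt (by simp)
  have h0 := hL.hasFDerivAt.clm_apply (hasFDerivAt_const Y z)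
  have h2 := (hd (h.ne_zero z hz)).hasFDerivAt.clm_apply (hasFDerivAt_const Y z)
  have h3 := (hd (h.map_ne_zero z hz)).hasFDerivAt.comp z
    ((h.smooth z hz).differentiableAt (by simp)).hasFDerivAt
  have h4 := h3.clm_apply (hasFDerivAt_fderiv_apply ((h.smooth z hz).of_le (by norm_num)) Y)
  have h5 := congrArg (fun T : GProd F H →L[ℝ] ℝ => T X)
    (h0.fderiv.symm.trans (h1.fderiv_eq.trans (h2.sub h4).fderiv))
  simp at h5
  rw [h5]
  ring

end GrushinConformal

end GrushinRigidity

section GrushinHessian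

open GProd

variable {α : ℝ} {F H : Type*} [NormedAddCommGroup F] [InnerProductSpace ℝ F]
  [NormedAddCommGroup H] [InnerProductSpace ℝ H]
  [FiniteDimensional ℝ F] [FiniteDimensional ℝ H]

namespace GrushinConformal

variable {Ω : Set (GProd F H)} {f : GProd F H → GProd F H} {L : GProd F H → ℝ} {z : GProd F H}
  {D : GProd F H ≃ₗ[ℝ] GProd F H}

variable [Nontrivial H] (hF : 3 ≤ Module.finrank ℝ F)
include hF

lemma fderiv_log_equiv (h : GrushinConformal α Ω f L) (hz : z ∈ Ω) (hD : IsDerivEquiv f z D)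
    (X : GProd F H) : fderiv ℝ (logRho α) (f z) (D X)
      = fderiv ℝ (logRho α) z X - fderiv ℝ L z X := by
  rw [h.fderiv_log hF hz, hD]
  ring

lemma fderiv_log_gradLogRho (h : GrushinConformal α Ω f L) (hz : z ∈ Ω) :
    fderiv ℝ L z (gradLogRho α z)
      = grushinMetric α z (grushinGrad α L z) (grushinGrad α L z) / 2 := by
  have := FiniteDimensional.complete ℝ F
  have := FiniteDimensional.complete ℝ H
  obtain ⟨D, hD⟩ := h.exists_derivEquiv hz
  have hz' := h.ne_zero z hz
  have hfz := h.map_ne_zero z hz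
  set e := gradLogRho α z
  set n := grushinGrad α L z
  have hE := Real.exp_pos (-2 * L z)
  have h0 : ∀ V, grushinMetric α (f z) (D (e - n)) V
      = Real.exp (-2 * L z) * fderiv ℝ (logRho α) (f z) V := by
    intro V
    obtain ⟨X, rfl⟩ := D.surjective V
    rw [h.conf_equiv hz hD, h.fderiv_log_equiv hF hz hD, map_sub, sub_apply,
      grushinMetric_gradLogRho h.pos hz', grushinMetric_grad h.pos hz']
  have h1 := h0 (D (e - n))
  rw [h.conf_equiv hz hD, ← grushinMetric_gradLogRho h.pos hfz,
    (grushin_isLeviCivita h.pos).symm _ hfz, h0, ← grushinMetric_gradLogRho h.pos hfz,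
    grushinMetric_gradLogRho_self h.pos hfz, h.rhoSq_eq hF hz, mul_inv,
    mul_inv_cancel_left₀ hE.ne', ← grushinMetric_gradLogRho_self h.pos hz'] at h1
  have h2 := mul_left_cancel₀ hE.ne' h1
  have h3 : grushinMetric α z e n = grushinMetric α z n e :=
    (grushin_isLeviCivita h.pos).symm z hz' e n
  simp only [map_sub, sub_apply] at h2
  rw [← grushinMetric_grad h.pos hz' L]
  change grushinMetric α z n e = _
  change _ = grushinMetric α z e e at h2
  linarith

lemma hess_log (h : GrushinConformal α Ω f L) (hz : z ∈ Ω) (hD : IsDerivEquiv f z D)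
    (X Y : GProd F H) :
    fderiv ℝ (fderiv ℝ L) z X Y - fderiv ℝ L z (grushinConn α z X Y)
        + fderiv ℝ L z X * fderiv ℝ L z Y
        - grushinMetric α z (grushinGrad α L z) (grushinGrad α L z) / 2 * grushinMetric α z X Y
      = (grushinMetric α z (grushinRefl H z.1 X) Y
          - grushinMetric α z (pullRefl (f z).1 D X) Y) / 2 / rhoSq α z := by
  have := FiniteDimensional.complete ℝ F
  have := FiniteDimensional.complete ℝ H
  have hz' := h.ne_zero z hz
  have hfz := h.map_ne_zero z hz
  have hE := (Real.exp_pos (-2 * L z)).ne'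
  have hr := (rhoSq_pos (α := α) hz').ne'
  have h1 := h.fderiv_fderiv_log hF hz X Y
  have h2 := eq_sub_of_add_eq (h.hessian hz X Y)
  rw [h2, map_sub, ← hD, ← hD, ← hD] at h1
  have h3 := hess_logRho (α := α) hz' X Y
  have h4 := hess_logRho (α := α) hfz (D X) (D Y)
  rw [← map_pullRefl, h.conf_equiv hz hD, h.conf_equiv hz hD, h.rhoSq_eq hF hz,
    ← mul_add, mul_div_assoc, mul_div_mul_left _ _ hE] at h4
  simp only [h.fderiv_log_equiv hF hz hD] at h1 h4
  have h5 : fderiv ℝ (logRho α) z (grushinGrad α L z)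
      = grushinMetric α z (grushinGrad α L z) (grushinGrad α L z) / 2 := by
    rw [← grushinMetric_gradLogRho h.pos hz', (grushin_isLeviCivita h.pos).symm z hz',
      grushinMetric_grad h.pos hz', h.fderiv_log_gradLogRho hF hz]
  have h6 := grushinMetric_grad h.pos hz' L (grushinGrad α L z)
  simp only [confConn, map_sub, map_add, map_smul, smul_eq_mul, h5, ← h6] at h1
  linear_combination h1 + h3 - h4

lemma pullRefl_eq (h : GrushinConformal α Ω f L) (hz : z ∈ Ω) (hD : IsDerivEquiv f z D)
    (U : GProd F H) : pullRefl (f z).1 D U = grushinRefl H z.1 U := by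
  obtain ⟨a, rfl | rfl, ha⟩ := (h.rigidity hF hz hD).2
  · simpa using ha U
  · exfalso
    have hα := h.pos
    have hr := rhoSq_pos (α := α) (h.ne_zero z hz)
    obtain ⟨X, Y, Z, W, hA⟩ := exists_isAdapted h.pos hF (h.ne_zero z hz)
    have hS {X : GProd F H} (hX : grushinRefl H z.1 X = X) (hXX : grushinMetric α z X X = 1) :
        schouten α L z X = (rhoSq α z)⁻¹ := by
      have h1 := h.hess_log hF hz hD X X
      rw [ha, hX] at h1
      simp only [map_smul, smul_apply, smul_eq_mul, hXX] at h1
      rw [schouten]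
      linear_combination h1
    have h1 := h.curv hz hD hA.hXX hA.hYY hA.hXY
    rw [hS hA.hX hA.hXX, hS hA.hY hA.hYY] at h1
    simp only [projArea, ha, hA.hX, hA.hY, map_smul, smul_apply, smul_eq_mul, hA.hXX, hA.hYY,
      hA.hXY, grushinK] at h1
    norm_num at h1
    field_simp at h1
    nlinarith

lemma hess_log_eq (h : GrushinConformal α Ω f L) (hz : z ∈ Ω) (X Y : GProd F H) :
    fderiv ℝ (fderiv ℝ L) z X Y = fderiv ℝ L z (grushinConn α z X Y)
        - fderiv ℝ L z X * fderiv ℝ L z Y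
        + fderiv ℝ L z (gradLogRho α z) * grushinMetric α z X Y := by
  obtain ⟨D, hD⟩ := h.exists_derivEquiv hz
  have h1 := h.hess_log hF hz hD X Y
  rw [h.pullRefl_eq hF hz hD, sub_self, zero_div, zero_div] at h1
  rw [h.fderiv_log_gradLogRho hF hz]
  linarith

lemma fderiv_log_refl (h : GrushinConformal α Ω f L) (hz : z ∈ Ω) (X : GProd F H) :
    fderiv ℝ L z (grushinRefl H z.1 X) = -fderiv ℝ L z X := by
  obtain ⟨D, hD⟩ := h.exists_derivEquiv hz
  have h1 := h.fderiv_log_equiv hF hz hD (grushinRefl H z.1 X)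
  rw [← h.pullRefl_eq hF hz hD, map_pullRefl, h.pullRefl_eq hF hz hD,
    fderiv_logRho_refl (h.map_ne_zero z hz), fderiv_logRho_refl (h.ne_zero z hz),
    h.fderiv_log_equiv hF hz hD] at h1
  linarith

lemma fderiv_log_radial (h : GrushinConformal α Ω f L) (hz : z ∈ Ω) (ξ : F) :
    fderiv ℝ L z (GProd.mk ξ 0) = ⟪z.1, ξ⟫ / ‖z.1‖ ^ 2 * fderiv ℝ L z (GProd.mk z.1 0) := by
  have h1 := h.fderiv_log_refl hF hz (GProd.mk ξ 0)
  have h2 : grushinRefl H z.1 (GProd.mk ξ 0)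
      = GProd.mk ξ 0 - (2 * ⟪z.1, ξ⟫ / ‖z.1‖ ^ 2) • (GProd.mk z.1 0 : GProd F H) := by
    apply GProd.ext <;> simp [grushinRefl_apply]
  rw [h2, map_sub, map_smul, smul_eq_mul] at h1
  linear_combination h1 / 2

end GrushinConformal

end GrushinHessian

section GrushinFactor

open GProd

variable {α : ℝ} {F H : Type*} [NormedAddCommGroup F] [InnerProductSpace ℝ F]
  [NormedAddCommGroup H] [InnerProductSpace ℝ H]

lemma hasFDerivAt_gradLogRho (hα : 0 < α) {z : GProd F H} (hz : z.1 ≠ 0) :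
    ∃ T : GProd F H →L[ℝ] GProd F H, HasFDerivAt (gradLogRho α) T z ∧
      ∀ X, grushinConn α z X (gradLogRho α z) + T X
        = GProd.mk ((rhoSq α z)⁻¹ • (X.1 - (2 * ⟪z.1, X.1⟫ / ‖z.1‖ ^ 2) • z.1)) 0 := by
  have ho : IsOpen {w : GProd F H | w.1 ≠ 0} := isOpen_ne.preimage (fstL F H).continuous
  have hr := rhoSq_pos (α := α) hz
  have h0 : gradLogRho α =ᶠ[𝓝 z] fun w => inlL F H
      (((α + 1)⁻¹ * Real.exp (-2 * logRho α w)) • fstL F H w) := by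
    filter_upwards [ho.mem_nhds hz] with w hw
    rw [neg_mul, Real.exp_neg, exp_two_mul_logRho hw, ← mul_inv]
    rfl
  have h1 := (((hasFDerivAt_logRho (α := α) hz).const_mul (-2)).exp.const_mul (α + 1)⁻¹).smul
    (fstL F H).hasFDerivAt
  have h2 := ((inlL F H).hasFDerivAt.comp z h1).congr_of_eventuallyEq h0
  refine ⟨_, h2, fun X => ?_⟩
  have hN : ‖z.1‖ ^ 2 ≠ 0 := pow_ne_zero _ (norm_ne_zero_iff.2 hz)
  have hα1 : α + 1 ≠ 0 := by positivity
  have hexp : Real.exp (-2 * logRho α z) = (rhoSq α z)⁻¹ := by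
    rw [neg_mul, Real.exp_neg, exp_two_mul_logRho hz]
  have hin : innerFst F H z X = ⟪z.1, X.1⟫ := rfl
  apply GProd.ext
  · simp only [grushinConn_apply, gradLogRho, mk_fst, add_fst, hexp, inner_smul_right,
      real_inner_self_eq_norm_sq, ContinuousLinearMap.comp_apply, inlL_apply, fstL_apply,
      add_apply, smul_apply, ContinuousLinearMap.smulRight_apply, hin, smul_eq_mul,
      real_inner_comm z.1 X.1]
    match_scalars <;> field_simp
    ring
  · simp [grushinConn_apply]

namespace GrushinConformal

variable [FiniteDimensional ℝ F] [FiniteDimensional ℝ H]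
  {Ω : Set (GProd F H)} {f : GProd F H → GProd F H} {L : GProd F H → ℝ} {z : GProd F H}

lemma hasFDerivAt_exp (h : GrushinConformal α Ω f L) (hz : z ∈ Ω) :
    HasFDerivAt (fun w => Real.exp (L w)) (Real.exp (L z) • fderiv ℝ L z) z :=
  ((h.smooth_log z hz).differentiableAt (by simp)).hasFDerivAt.exp

lemma differentiableAt_fderiv (h : GrushinConformal α Ω f L) (hz : z ∈ Ω) :
    DifferentiableAt ℝ (fderiv ℝ L) z :=
  ((h.smooth_log z hz).fderiv_right (m := 1) (by norm_num)).differentiableAt (by simp)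

variable [Nontrivial H] (hF : 3 ≤ Module.finrank ℝ F)
include hF

lemma hasFDerivAt_radial (h : GrushinConformal α Ω f L) (hz : z ∈ Ω) :
    HasFDerivAt (fun w => Real.exp (L w) * fderiv ℝ L w (gradLogRho α w))
      (0 : GProd F H →L[ℝ] ℝ) z := by
  have hz' := h.ne_zero z hz
  obtain ⟨T, hT, hT'⟩ := hasFDerivAt_gradLogRho h.pos hz'
  have h1 := (h.hasFDerivAt_exp hz).mul
    ((h.differentiableAt_fderiv hz).hasFDerivAt.clm_apply hT)
  refine h1.congr_fderiv (ContinuousLinearMap.ext fun X => ?_)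
  simp only [add_apply, smul_apply, smul_eq_mul, ContinuousLinearMap.comp_apply,
    ContinuousLinearMap.flip_apply, zero_apply]
  have hα := h.pos
  have hα1 : α + 1 ≠ 0 := by positivity
  have hN : ‖z.1‖ ^ 2 ≠ 0 := pow_ne_zero _ (norm_ne_zero_iff.2 hz')
  have hr := (rhoSq_pos (α := α) hz').ne'
  have h2 := h.hess_log_eq hF hz X (gradLogRho α z)
  rw [(grushin_isLeviCivita h.pos).symm z hz', grushinMetric_gradLogRho h.pos hz',
    fderiv_logRho hz'] at h2
  have h3 := congrArg (fderiv ℝ L z) (hT' X)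
  rw [map_add, h.fderiv_log_radial hF hz, inner_smul_right, inner_sub_right, inner_smul_right,
    real_inner_self_eq_norm_sq] at h3
  have h4 : fderiv ℝ L z (gradLogRho α z)
      = ((α + 1) * rhoSq α z)⁻¹ * fderiv ℝ L z (GProd.mk z.1 0) := by
    rw [← smul_eq_mul, ← map_smul]
    congr 1
    apply GProd.ext <;> simp [gradLogRho]
  rw [h2, eq_sub_of_add_eq' h3, h4]
  field_simp
  ring

lemma hasFDerivAt_vertical (h : GrushinConformal α Ω f L) (hz : z ∈ Ω) (w : H) :
    HasFDerivAt (fun v => Real.exp (L v) * fderiv ℝ L v (GProd.mk 0 w))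
      ((Real.exp (L z) * fderiv ℝ L z (gradLogRho α z)) • (innerSnd F H (GProd.mk 0 w))) z := by
  have h1 := (h.hasFDerivAt_exp hz).mul
    ((h.differentiableAt_fderiv hz).hasFDerivAt.clm_apply
      (hasFDerivAt_const (GProd.mk 0 w : GProd F H) z))
  refine h1.congr_fderiv (ContinuousLinearMap.ext fun X => ?_)
  have h2 := h.hess_log_eq hF hz X (GProd.mk 0 w)
  have h3 : grushinConn α z X (GProd.mk 0 w) = 0 := by
    apply GProd.ext <;> simp [grushinConn_apply]
  have h4 : innerSnd F H (GProd.mk 0 w) X = ⟪w, X.2⟫ := rfl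
  rw [h3, map_zero] at h2
  simp only [grushinMetric_apply, mk_fst, mk_snd, inner_zero_right, real_inner_comm w X.2] at h2
  simp only [add_apply, smul_apply, smul_eq_mul, ContinuousLinearMap.comp_apply,
    ContinuousLinearMap.flip_apply, zero_apply, map_zero, h2, h4]
  ring

lemma grad_self (h : GrushinConformal α Ω f L) (hz : z ∈ Ω) :
    2 * fderiv ℝ L z (gradLogRho α z)
      = rhoSq α z * fderiv ℝ L z (gradLogRho α z) ^ 2 + ‖(grushinGrad α L z).2‖ ^ 2 := by
  have := FiniteDimensional.complete ℝ F
  have := FiniteDimensional.complete ℝ H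
  have hz' := h.ne_zero z hz
  have hα := h.pos
  have hα1 : α + 1 ≠ 0 := by positivity
  have hN : ‖z.1‖ ^ 2 ≠ 0 := pow_ne_zero _ (norm_ne_zero_iff.2 hz')
  have hφ : ‖z.1‖ ^ (2 * α) ≠ 0 := (Real.rpow_pos_of_pos (norm_pos_iff.2 hz') _).ne'
  have h1 := h.fderiv_log_gradLogRho hF hz
  set n := grushinGrad α L z
  have h2 : fderiv ℝ L z n = grushinMetric α z n n := (grushinMetric_grad h.pos hz' L n).symm
  have h3 : fderiv ℝ L z n
      = fderiv ℝ L z (GProd.mk n.1 0) + grushinMetric α z n (GProd.mk 0 n.2) := by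
    rw [grushinMetric_grad h.pos hz', ← map_add]
    congr 1
    apply GProd.ext <;> simp
  have h4 : grushinMetric α z n (GProd.mk z.1 0) = fderiv ℝ L z (GProd.mk z.1 0) :=
    grushinMetric_grad h.pos hz' L _
  have h5 : fderiv ℝ L z (gradLogRho α z)
      = ((α + 1) * rhoSq α z)⁻¹ * fderiv ℝ L z (GProd.mk z.1 0) := by
    rw [← smul_eq_mul, ← map_smul]
    congr 1
    apply GProd.ext <;> simp [gradLogRho]
  rw [h.fderiv_log_radial hF hz, ← h4] at h3
  rw [← h4] at h5
  rw [mul_comm (2 : ℝ), h1, div_mul_cancel₀ _ two_ne_zero, ← h1, h5, ← h2, h3]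
  simp only [grushinMetric_apply, mk_fst, mk_snd, inner_zero_right, real_inner_self_eq_norm_sq,
    rhoSq, real_inner_comm n.1 z.1]
  field_simp
  ring

theorem exp_log_eq (h : GrushinConformal α Ω f L) (hΩ : IsConnected Ω) :
    (∃ c : ℝ, ∀ z ∈ Ω, Real.exp (L z) = c) ∨
      ∃ a : ℝ, 0 < a ∧ ∃ b : H, ∀ z ∈ Ω,
        Real.exp (L z) = a * (rhoSq α z + ‖z.2 - b‖ ^ 2) := by
  have := FiniteDimensional.complete ℝ F
  have := FiniteDimensional.complete ℝ H
  obtain ⟨m, hm⟩ := h.isOpen.exists_is_const_of_fderiv_eq_zero hΩ.isPreconnected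
    (fun z hz => (h.hasFDerivAt_radial hF hz).differentiableAt.differentiableWithinAt)
    (fun z hz => (h.hasFDerivAt_radial hF hz).fderiv)
  rcases eq_or_ne m 0 with rfl | hm0
  · left
    refine h.isOpen.exists_is_const_of_fderiv_eq_zero (𝕜 := ℝ) hΩ.isPreconnected
      (fun z hz => (h.hasFDerivAt_exp hz).differentiableAt.differentiableWithinAt)
      fun z hz => ?_
    have h1 : fderiv ℝ L z (gradLogRho α z) = 0 :=
      (mul_eq_zero.1 (hm z hz)).resolve_left (Real.exp_pos _).ne'
    have h2 := h.fderiv_log_gradLogRho hF hz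
    have h3 : grushinGrad α L z = 0 := by
      by_contra hne
      have := (grushin_isLeviCivita h.pos).pos z (h.ne_zero z hz) _ hne
      linarith
    rw [(h.hasFDerivAt_exp hz).fderiv]
    ext X
    simp [← grushinMetric_grad h.pos (h.ne_zero z hz) L X, h3]
  · right
    obtain ⟨z₀, hz₀⟩ := hΩ.nonempty
    set b : H := z₀.2 - (m⁻¹ * Real.exp (L z₀)) • (grushinGrad α L z₀).2
    have hb (z : GProd F H) (hz : z ∈ Ω) :
        Real.exp (L z) • (grushinGrad α L z).2 = m • (z.2 - b) := by
      refine ext_inner_right ℝ fun w => ?_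
      have hd (v : GProd F H) (hv : v ∈ Ω) : HasFDerivAt
          (fun v => Real.exp (L v) * fderiv ℝ L v (GProd.mk 0 w)
            - m * innerSnd F H (GProd.mk 0 w) v) (0 : GProd F H →L[ℝ] ℝ) v := by
        refine ((h.hasFDerivAt_vertical hF hv w).sub
          ((innerSnd F H (GProd.mk 0 w)).hasFDerivAt.const_mul m)).congr_fderiv ?_
        rw [hm v hv, sub_self]
      have h1 := h.isOpen.is_const_of_fderiv_eq_zero hΩ.isPreconnected
        (fun v hv => (hd v hv).differentiableAt.differentiableWithinAt)
        (fun v hv => (hd v hv).fderiv) hz hz₀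
      have h2 (v : GProd F H) : innerSnd F H (GProd.mk 0 w) v = ⟪v.2, w⟫ := real_inner_comm _ _
      have h3 (v : GProd F H) (hv : v ∈ Ω) :
          fderiv ℝ L v (GProd.mk 0 w) = ⟪(grushinGrad α L v).2, w⟫ := by
        rw [← grushinMetric_grad h.pos (h.ne_zero v hv) L]
        simp [grushinMetric_apply]
      simp only [h2, h3 z hz, h3 z₀ hz₀] at h1
      simp only [b, real_inner_smul_left, inner_sub_left]
      field_simp
      linarith
    have key (z : GProd F H) (hz : z ∈ Ω) :
        Real.exp (L z) = m / 2 * (rhoSq α z + ‖z.2 - b‖ ^ 2) := by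
      have h1 := h.grad_self hF hz
      have h2 := hm z hz
      have h3 := congrArg (‖·‖ ^ 2) (hb z hz)
      simp only [norm_smul, mul_pow, Real.norm_eq_abs, sq_abs] at h3
      have h4 : 2 * m * Real.exp (L z) = m ^ 2 * (rhoSq α z + ‖z.2 - b‖ ^ 2) := by
        rw [← h2] at *
        linear_combination Real.exp (L z) ^ 2 * h1 + h3
      refine mul_left_cancel₀ (mul_ne_zero two_ne_zero hm0) ?_
      linear_combination h4
    refine ⟨m / 2, ?_, b, key⟩
    have h1 := key z₀ hz₀
    have h2 : 0 < rhoSq α z₀ + ‖z₀.2 - b‖ ^ 2 :=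
      add_pos_of_pos_of_nonneg (rhoSq_pos (h.ne_zero z₀ hz₀)) (sq_nonneg _)
    exact (mul_pos_iff_of_pos_right h2).1 (h1 ▸ Real.exp_pos _)

end GrushinConformal

end GrushinFactor

lemma contDiffAt_log_conformalFactor {α : ℝ} {p q : ℕ} [NeZero q] {Ω : Set (GVec p q)}
    (hΩo : IsOpen Ω) {f : GVec p q → GVec p q} (hmaps : Set.MapsTo f Ω (GM0 p q))
    (hf : ∀ z ∈ Ω, ContDiffAt ℝ (⊤ : ℕ∞) f z) {u : GVec p q → ℝ} (hu : ∀ z ∈ Ω, 0 < u z)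
    (hconf : ∀ z ∈ Ω, ∀ U V : GVec p q,
      gMet α p q (f z).1 (fderiv ℝ f z U) (fderiv ℝ f z V) = (u z ^ 2)⁻¹ * gMet α p q z.1 U V) :
    ∀ z ∈ Ω, ContDiffAt ℝ 2 (fun z => Real.log (u z)) z := by
  intro z hz
  set X : GVec p q := (0, EuclideanSpace.single 0 1)
  have h1 : ∀ w ∈ Ω, (α + 1) ^ 2 * ‖(f w).1‖ ^ (2 * α)
      * ⟪(fderiv ℝ f w X).1, (fderiv ℝ f w X).1⟫ + ⟪(fderiv ℝ f w X).2, (fderiv ℝ f w X).2⟫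
      = (u w ^ 2)⁻¹ := by
    intro w hw
    refine (hconf w hw X X).trans ?_
    simp [gMet, X]
  have h2 : ContDiffAt ℝ 2 (fun w => fderiv ℝ f w X) z :=
    (((hf z hz).of_le (by norm_cast) : ContDiffAt ℝ 3 f z).fderiv_right
      (by norm_num)).clm_apply contDiffAt_const
  have h3 : ContDiffAt ℝ 2 (fun w => ‖(f w).1‖ ^ (2 * α)) z :=
    (((hf z hz).of_le (by norm_cast)).fst.norm ℝ (hmaps hz)).rpow_const_of_ne
      (norm_ne_zero_iff.2 (hmaps hz))
  have h4 := ((contDiffAt_const (c := (α + 1) ^ 2)).mul h3).mul (h2.fst.inner ℝ h2.fst) |>.add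
    (h2.snd.inner ℝ h2.snd)
  have h5 := (h4.log (by
    have := (inv_pos.2 (pow_pos (hu z hz) 2)).ne'
    rwa [← h1 z hz] at this)).mul (contDiffAt_const (c := (-1 / 2 : ℝ)))
  refine h5.congr_of_eventuallyEq (Filter.eventually_of_mem (hΩo.mem_nhds hz) fun w hw => ?_)
  refine Eq.trans ?_ (congrArg (fun t => Real.log t * (-1 / 2)) (h1 w hw)).symm
  simp only [Real.log_inv, Real.log_pow]
  push_cast
  ring

/-- the conformal factor of a conformal diffeomorphism of `(M₀, g)` is either
constant or of the form `a(|x|^{2(α+1)} + |y − b|²) = a‖(x, y−b)‖^{2(α+1)}`, `p ≥ 3`. -/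
theorem grushin_conformal_factor_classification
    (α : ℝ) (hα : 0 < α) (p q : ℕ) (hp : 3 ≤ p) (hq : 1 ≤ q)
    (Ω : Set (GVec p q)) (hΩ : Ω ⊆ GM0 p q) (hΩo : IsOpen Ω) (hΩc : IsConnected Ω)
    (f : GVec p q → GVec p q) (hmaps : Set.MapsTo f Ω (GM0 p q))
    (hf : ContDiffOn ℝ (⊤ : ℕ∞) f Ω) (hinj : Set.InjOn f Ω)
    (u : GVec p q → ℝ) (hu : ∀ z ∈ Ω, 0 < u z)
    (hconf : ∀ z ∈ Ω, ∀ U V : GVec p q,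
      gMet α p q (f z).1 (fderiv ℝ f z U) (fderiv ℝ f z V) = (u z ^ 2)⁻¹ * gMet α p q z.1 U V) :
    (∃ c : ℝ, ∀ z ∈ Ω, u z = c) ∨
    (∃ a : ℝ, 0 < a ∧ ∃ b : EuclideanSpace ℝ (Fin q), ∀ z ∈ Ω,
      u z = a * (‖z.1‖ ^ (2 * (α + 1)) + ‖z.2 - b‖ ^ 2) ∧
      u z = a * homNorm α p q (z.1, z.2 - b) ^ (2 * (α + 1))) := by
  have hq' : NeZero q := ⟨by omega⟩
  have hexp : ∀ z ∈ Ω, Real.exp (Real.log (u z)) = u z := fun z hz => Real.exp_log (hu z hz)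
  have hfd : ∀ z ∈ Ω, ContDiffAt ℝ (⊤ : ℕ∞) f z := fun z hz => hf.contDiffAt (hΩo.mem_nhds hz)
  have h : GrushinConformal (F := EuclideanSpace ℝ (Fin p)) (H := EuclideanSpace ℝ (Fin q)) α Ω f
      (fun z => Real.log (u z)) := by
    refine ⟨hα, hΩo, hΩ, hmaps, fun z hz => (hfd z hz).of_le (by norm_cast), ?_, ?_⟩
    · exact contDiffAt_log_conformalFactor hΩo hmaps hfd hu hconf
    · intro z hz U V
      refine (hconf z hz U V).trans ?_
      congr 1
      rw [neg_mul, Real.exp_neg, two_mul, Real.exp_add, hexp z hz, sq]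
  have hF : 3 ≤ Module.finrank ℝ (EuclideanSpace ℝ (Fin p)) := by simpa using hp
  refine (h.exp_log_eq hF hΩc).imp ?_ ?_
  · rintro ⟨c, hc⟩
    exact ⟨c, fun z hz => (hexp z hz).symm.trans (hc z hz)⟩
  · rintro ⟨a, ha, b, hb⟩
    refine ⟨a, ha, b, fun z hz => ?_⟩
    have h1 : 0 < ‖z.1‖ := norm_pos_iff.2 (hΩ hz)
    have h2 : u z = a * (‖z.1‖ ^ (2 * (α + 1)) + ‖z.2 - b‖ ^ 2) := by
      refine (hexp z hz).symm.trans ((hb z hz).trans ?_)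
      rw [mul_add 2 α, Real.rpow_add h1, mul_one, Real.rpow_two]
      rfl
    refine ⟨h2, h2.trans ?_⟩
    rw [homNorm, ← Real.rpow_mul (by positivity), one_div_mul_cancel (by positivity), Real.rpow_one]

end
end

section
/- Let p ≥ 2 and q ≥ 1. For every z = (x,y) ∈ M₀ and all U, V, X, Y ∈ ℝ^{p+q}, the Riemann curvature tensor of g satisfies R_z(U, V, X, Y) = −α(α+2)(α+1)^{-2} |x|^{-2(α+1)} [ g_z(U_S, X_S) g_z(V_S, Y_S) − g_z(U_S, Y_S) g_z(V_S, X_S) ], where U_S, V_S, X_S, Y_S denote the g-orthogonal projections onto the vertical subspace T_z S. -/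
noncomputable section

open scoped RealInnerProductSpace

/-- The contraction of the Christoffel symbols, with the real power written as an inverse square. -/
lemma gammaMap_eq (α : ℝ) (p q : ℕ) (x : EuclideanSpace ℝ (Fin p)) (U V : GVec p q) :
    gammaMap α p q x U V =
      ((α * (⟪x, x⟫)⁻¹) • (⟪x, V.1⟫ • U.1 + ⟪x, U.1⟫ • V.1 - ⟪U.1, V.1⟫ • x), 0) := by
  rw [gammaMap, Real.rpow_neg (norm_nonneg x), Real.rpow_two, real_inner_self_eq_norm_sq]

/-- Derivative of the contracted Christoffel symbols along a constant direction. -/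
lemma fderiv_gammaMap_apply (α : ℝ) (p q : ℕ) (z : GVec p q) (hz : z.1 ≠ 0) (X Y Z : GVec p q) :
    fderiv ℝ (fun w : GVec p q => gammaMap α p q w.1 Y Z) z X =
      ((α * (⟪z.1, z.1⟫)⁻¹) • (⟪X.1, Z.1⟫ • Y.1 + ⟪X.1, Y.1⟫ • Z.1 - ⟪Y.1, Z.1⟫ • X.1)
        - (2 * α * ⟪z.1, X.1⟫ * ((⟪z.1, z.1⟫) ^ 2)⁻¹) •
          (⟪z.1, Z.1⟫ • Y.1 + ⟪z.1, Y.1⟫ • Z.1 - ⟪Y.1, Z.1⟫ • z.1), 0) := by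
  have hs : ⟪z.1, z.1⟫ ≠ 0 := inner_self_ne_zero.mpr hz
  have hfst : HasFDerivAt (fun w : GVec p q => w.1) (ContinuousLinearMap.fst ℝ _ _) z :=
    hasFDerivAt_fst
  have hinner (v : EuclideanSpace ℝ (Fin p)) :=
    hfst.inner ℝ (hasFDerivAt_const v z)
  have hcoef := ((hasDerivAt_inv hs).comp_hasFDerivAt z (hfst.inner ℝ hfst)).const_mul α
  have hvec := (((hinner Z.1).smul_const Y.1).add ((hinner Y.1).smul_const Z.1)).sub
    (hfst.const_smul ⟪Y.1, Z.1⟫)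
  have hmain := (hcoef.smul hvec).prodMk (hasFDerivAt_const (0 : EuclideanSpace ℝ (Fin q)) z)
  have hfun : (fun w : GVec p q => gammaMap α p q w.1 Y Z) = fun w : GVec p q =>
      ((α * (⟪w.1, w.1⟫)⁻¹) • (⟪w.1, Z.1⟫ • Y.1 + ⟪w.1, Y.1⟫ • Z.1 - ⟪Y.1, Z.1⟫ • w.1),
        (0 : EuclideanSpace ℝ (Fin q))) := by
    funext w
    exact gammaMap_eq α p q w.1 Y Z
  rw [hfun]
  refine (congrArg (fun L => L X) hmain.fderiv).trans ?_
  refine Prod.ext ?_ (by simp)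
  simp [fderivInnerCLM_apply, real_inner_comm z.1 X.1]
  module

/-- explicit formula for the Riemann curvature tensor of `g` on `M₀`. -/
theorem grushin_riemann_formula
    (α : ℝ) (hα : 0 < α) (p q : ℕ) (hp : 2 ≤ p) (hq : 1 ≤ q)
    (z : GVec p q) (hz : z ∈ GM0 p q) (U V X Y : GVec p q) :
    riem α p q z U V X Y =
      -(α * (α + 2) * ((α + 1) ^ 2)⁻¹ * ‖z.1‖ ^ (-(2 * (α + 1)))) *
        (gMet α p q z.1 (projS p q z U) (projS p q z X) *
            gMet α p q z.1 (projS p q z V) (projS p q z Y)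
          - gMet α p q z.1 (projS p q z U) (projS p q z Y) *
            gMet α p q z.1 (projS p q z V) (projS p q z X)) := by
  have hx : z.1 ≠ 0 := hz
  have hn : 0 < ‖z.1‖ := norm_pos_iff.mpr hx
  have hpow : ‖z.1‖ ^ (-(2 * (α + 1))) = (‖z.1‖ ^ (2 * α))⁻¹ * (‖z.1‖ ^ 2)⁻¹ := by
    rw [Real.rpow_neg hn.le, mul_add, Real.rpow_add hn, mul_inv, mul_one, Real.rpow_two]
  have hα1 : α + 1 ≠ 0 := by positivity
  have hr : ‖z.1‖ ^ (2 * α) ≠ 0 := (Real.rpow_pos_of_pos hn _).ne'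
  simp only [riem, curvOp, covDeriv, fderiv_gammaMap_apply α p q z hx]
  simp only [gammaMap_eq, gMet, projS, hpow, Prod.fst_add, Prod.snd_add, Prod.fst_sub,
    Prod.snd_sub, inner_add_right, inner_sub_left, inner_sub_right, real_inner_smul_left,
    real_inner_smul_right, inner_zero_right, add_zero, sub_zero, real_inner_self_eq_norm_sq]
  simp only [real_inner_comm z.1 U.1, real_inner_comm z.1 V.1, real_inner_comm z.1 X.1,
    real_inner_comm z.1 Y.1, real_inner_comm V.1 X.1, real_inner_comm V.1 Y.1,
    real_inner_comm X.1 Y.1]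
  generalize ‖z.1‖ ^ (2 * α) = r at *
  field_simp
  ring

end
end
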